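/- arXiv:1411.0290 — 8 statements merged into one kernel-verified Lean document; each statement's English description precedes it below -/
import Mathlib

section
/- If G is a connected triangle-free finite simple graph with at least two vertices that admits an interval cyclic t-coloring for some t (i.e., G ∈ N_c), then the greatest such t satisfies W_c(G) ≤ |V(G)| + Δ(G) − 2, where Δ(G) is the maximum degree of G. Equivalently: every interval cyclic t-coloring of such a graph G satisfies t ≤ |V(G)| + Δ(G) − 2. -/
attribute [local instance] Classical.propDecidable

namespace IntervalCyclic

variable {V : Type*}

/-- An interval cyclic `t`-coloring: a proper edge-coloring with colors viewed as
elements of `ZMod t` (representing the colors `1,…,t` cyclically) such that all `t`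
colors are used and, at every vertex `v`, the set of colors on the edges incident to
`v` is a set of `d_G(v)` consecutive colors modulo `t`. -/
def IsIntervalCyclicColoring [Fintype V] (G : SimpleGraph V) (t : ℕ)
    (c : Sym2 V → ZMod t) : Prop :=
  (∀ v w w' : V, G.Adj v w → G.Adj v w' → w ≠ w' → c s(v, w) ≠ c s(v, w')) ∧
  (∀ x : ZMod t, ∃ e ∈ G.edgeSet, c e = x) ∧
  (∀ v : V, ∃ k : ZMod t,
    (G.neighborFinset v).image (fun w => c s(v, w)) =
      (Finset.range (G.degree v)).image (fun i => k + (i : ZMod t)))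

/-- `G` has an interval cyclic `t`-coloring for the positive integer `t`. -/
def HasIntervalCyclicColoring [Fintype V] (G : SimpleGraph V) (t : ℕ) : Prop :=
  0 < t ∧ ∃ c : Sym2 V → ZMod t, IsIntervalCyclicColoring G t c

/-- The greatest `t` for which `G` has an interval cyclic `t`-coloring. -/
noncomputable def Wc [Fintype V] (G : SimpleGraph V) : ℕ :=
  sSup {t | HasIntervalCyclicColoring G t}

/-- The least `t` for which `G` has an interval cyclic `t`-coloring. -/
noncomputable def wc [Fintype V] (G : SimpleGraph V) : ℕ :=
  sInf {t | HasIntervalCyclicColoring G t}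

/-- The graph on `V × ℤ` in which a vertex `(v, a)` stands for `v` together with the integer
interval `[a, a + d(v))` of colors, and adjacent vertices agree on the color of their edge. -/
def liftGraph {V : Type*} (G : SimpleGraph V) (pos : V → V → ℤ) : SimpleGraph (V × ℤ) where
  Adj p q := G.Adj p.1 q.1 ∧ p.2 + pos p.1 q.1 = q.2 + pos q.1 p.1
  symm := ⟨fun _ _ h => ⟨h.1.symm, h.2.symm⟩⟩
  loopless := ⟨fun _ h => G.irrefl h.1⟩

/-- `pos v` numbers the neighbors of `v` by `0, …, d(v) - 1`. -/
structure IsLocalNumbering {V : Type*} [Fintype V] (G : SimpleGraph V) [DecidableRel G.Adj]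
    (pos : V → V → ℤ) : Prop where
  nonneg : ∀ v w, G.Adj v w → 0 ≤ pos v w
  lt : ∀ v w, G.Adj v w → pos v w < G.degree v
  inj : ∀ v w w', G.Adj v w → G.Adj v w' → pos v w = pos v w' → w = w'
  surj : ∀ v (j : ℤ), 0 ≤ j → j < G.degree v → ∃ w, G.Adj v w ∧ pos v w = j

/-- The right end (exclusive) of the interval of colors of a vertex of the lifted graph. -/
def top {V : Type*} [Fintype V] (G : SimpleGraph V) [DecidableRel G.Adj] (p : V × ℤ) : ℤ :=
  p.2 + G.degree p.1

/-- `y 0, …, y k` is a shortest path of the lifted graph, and the sum of the right ends of its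
intervals is as large as possible among the shortest paths with the same ends. -/
structure IsOptimal {V : Type*} [Fintype V] (G : SimpleGraph V) [DecidableRel G.Adj]
    (pos : V → V → ℤ) (k : ℕ) (y : ℕ → V × ℤ) : Prop where
  adj : ∀ i < k, (liftGraph G pos).Adj (y i) (y (i + 1))
  le_length : ∀ p : (liftGraph G pos).Walk (y 0) (y k), k ≤ p.length
  sum_le : ∀ y' : ℕ → V × ℤ, y' 0 = y 0 → y' k = y k →
    (∀ i < k, (liftGraph G pos).Adj (y' i) (y' (i + 1))) →
    ∑ i ∈ Finset.range (k + 1), top G (y' i) ≤ ∑ i ∈ Finset.range (k + 1), top G (y i)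

section

variable {V : Type*} {G : SimpleGraph V} {pos : V → V → ℤ}

lemma liftGraph_adj_lift {v w : V} (a : ℤ) (h : G.Adj v w) :
    (liftGraph G pos).Adj (v, a) (w, a + pos v w - pos w v) :=
  ⟨h, by simp⟩

lemma exists_walk_of_adj {W : Type*} {H : SimpleGraph W} {y : ℕ → W} {k : ℕ}
    (hy : ∀ i < k, H.Adj (y i) (y (i + 1))) {i j : ℕ} (hij : i ≤ j) (hj : j ≤ k) :
    ∃ p : H.Walk (y i) (y j), p.length = j - i := by
  induction j, hij using Nat.le_induction with
  | base => exact ⟨.nil, by simp⟩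
  | succ n hn ih =>
    obtain ⟨p, hp⟩ := ih (by omega)
    exact ⟨p.concat (hy n (by omega)), by rw [SimpleGraph.Walk.length_concat]; omega⟩

lemma walk_residue {t : ℕ} {κ : V → ZMod t}
    (hκ : ∀ v w, G.Adj v w → κ v + (pos v w : ZMod t) = κ w + (pos w v : ZMod t))
    {P Q : V × ℤ} (p : (liftGraph G pos).Walk P Q) :
    (P.2 : ZMod t) - κ P.1 = (Q.2 : ZMod t) - κ Q.1 := by
  induction p with
  | nil => rfl
  | cons hadj _ ih =>
    rw [← ih]
    have h1 := congrArg (fun n : ℤ => (n : ZMod t)) hadj.2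
    have h2 := hκ _ _ hadj.1
    push_cast at h1
    linear_combination h1 - h2

lemma exists_lift_walk {u v : V} (p : G.Walk u v) (a : ℤ) :
    ∃ b, (liftGraph G pos).Reachable (u, a) (v, b) := by
  induction p generalizing a with
  | nil => exact ⟨a, .rfl⟩
  | cons hadj _ ih =>
    obtain ⟨b, hb⟩ := ih _
    exact ⟨b, (liftGraph_adj_lift a hadj).reachable.trans hb⟩

end

section

variable {V : Type*} [Fintype V] {G : SimpleGraph V} [DecidableRel G.Adj] {pos : V → V → ℤ}

lemma IsLocalNumbering.le_color (h : IsLocalNumbering G pos) {p q : V × ℤ}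
    (hpq : (liftGraph G pos).Adj p q) : p.2 ≤ p.2 + pos p.1 q.1 := by
  have := h.nonneg _ _ hpq.1
  omega

lemma IsLocalNumbering.color_lt_top (h : IsLocalNumbering G pos) {p q : V × ℤ}
    (hpq : (liftGraph G pos).Adj p q) : p.2 + pos p.1 q.1 < top G p := by
  have := h.lt _ _ hpq.1
  unfold top
  omega

/-- Every color between the ends of a path is taken at the first vertex reaching beyond it. -/
lemma IsLocalNumbering.exists_color (h : IsLocalNumbering G pos) {y : ℕ → V × ℤ} {k : ℕ}
    (hy : ∀ i < k, (liftGraph G pos).Adj (y i) (y (i + 1))) {j : ℤ} (h0 : (y 0).2 ≤ j)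
    (hk : j < top G (y k)) :
    ∃ i ≤ k, ∃ w, G.Adj (y i).1 w ∧ (y i).2 + pos (y i).1 w = j ∧
      ∀ l < i, top G (y l) ≤ j := by
  have hex : ∃ i, j < top G (y i) := ⟨k, hk⟩
  classical
  have hs := Nat.find_spec hex
  have hmin : ∀ l < Nat.find hex, top G (y l) ≤ j := fun l hl => by
    simpa using Nat.find_min hex hl
  have hle : Nat.find hex ≤ k := Nat.find_min' hex hk
  generalize Nat.find hex = i at *
  have ha : (y i).2 ≤ j := by
    rcases i with _ | i
    · exact h0
    · have hadj := hy i (by omega)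
      have h1 := h.le_color hadj.symm
      have h2 := h.color_lt_top hadj
      have h3 := hadj.2
      have h4 := hmin i (by omega)
      omega
  obtain ⟨w, hw, hp⟩ := h.surj (y i).1 (j - (y i).2) (by omega) (by unfold top at hs; omega)
  exact ⟨i, hle, w, hw, by omega, hmin⟩

lemma IsLocalNumbering.exists_isOptimal (h : IsLocalNumbering G pos) {P Q : V × ℤ}
    (p : (liftGraph G pos).Walk P Q)
    (hp : ∀ q : (liftGraph G pos).Walk P Q, p.length ≤ q.length) :
    ∃ y, IsOptimal G pos p.length y ∧ y 0 = P ∧ y p.length = Q := by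
  set k := p.length with hk
  let C : ℤ → Prop := fun s => ∃ y : ℕ → V × ℤ, y 0 = P ∧ y k = Q ∧
    (∀ i < k, (liftGraph G pos).Adj (y i) (y (i + 1))) ∧
    ∑ i ∈ Finset.range (k + 1), top G (y i) = s
  have hne : ∃ s, C s := ⟨_, p.getVert, by simp, by simp [hk],
    fun i hi => p.adj_getVert_succ (hk ▸ hi), rfl⟩
  have hbdd : ∃ b : ℤ, ∀ s, C s → s ≤ b := by
    refine ⟨∑ i ∈ Finset.range (k + 1), (P.2 + (i + 1) * Fintype.card V), ?_⟩
    rintro s ⟨y, h0, -, hy, rfl⟩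
    have hdeg : ∀ v, (G.degree v : ℤ) ≤ Fintype.card V := fun v => by
      exact_mod_cast (G.degree_lt_card_verts v).le
    have key : ∀ i ≤ k, (y i).2 ≤ P.2 + i * Fintype.card V := by
      intro i
      induction i with
      | zero => intro _; simp [h0]
      | succ n ih =>
        intro hn
        have h1 := ih (by omega)
        have hadj := hy n (by omega)
        have h2 := h.le_color hadj.symm
        have h3 := h.color_lt_top hadj
        have h4 := hadj.2
        have h5 := hdeg (y n).1
        unfold top at h3
        push_cast
        linarith
    refine Finset.sum_le_sum fun i hi => ?_
    have h1 := key i (by simpa [Nat.lt_succ_iff] using hi)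
    have h5 := hdeg (y i).1
    unfold top
    linarith
  obtain ⟨s, ⟨y, h0, h1, hy, rfl⟩, hmax⟩ := Int.exists_greatest_of_bdd hbdd hne
  refine ⟨y, ⟨hy, ?_, ?_⟩, h0, h1⟩
  · rw [h0, h1]
    exact hp
  · intro y' h0' h1' hy'
    exact hmax _ ⟨y', h0'.trans h0, h1'.trans h1, hy', rfl⟩

/-- On an optimal path, two vertices with a common neighbor `z` in the lifted graph cannot both
use `z` for a color that is new at the later one. -/
lemma IsOptimal.not_common_neighbor (h : IsLocalNumbering G pos) (htf : G.CliqueFree 3)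
    {y : ℕ → V × ℤ} {k : ℕ} (hy : IsOptimal G pos k y) {i i' : ℕ} (hii : i < i') (hk : i' ≤ k)
    {z : V × ℤ} (hz : (liftGraph G pos).Adj (y i) z) (hz' : (liftGraph G pos).Adj (y i') z)
    (hnew : ∀ l < i', top G (y l) ≤ (y i').2 + pos (y i').1 z.1) : False := by
  classical
  obtain rfl | rfl | hlt : i' = i + 1 ∨ i' = i + 2 ∨ i + 3 ≤ i' := by omega
  · exact htf _ (SimpleGraph.is3Clique_triple_iff.2
      ⟨(hy.adj i (by omega)).1, hz.1, hz'.1⟩)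
  · have hlt : ∑ l ∈ Finset.range (k + 1), top G (y l) <
        ∑ l ∈ Finset.range (k + 1), top G (Function.update y (i + 1) z l) := by
      have hz1 : top G (y (i + 1)) < top G z := by
        have h1 := hnew (i + 1) (by omega)
        have h2 := h.color_lt_top hz'.symm
        have h3 := hz'.2
        omega
      refine Finset.sum_lt_sum (fun l _ => ?_) ⟨i + 1, by simp; omega, by simpa using hz1⟩
      by_cases hl : l = i + 1
      · subst hl
        simpa using hz1.le
      · simp [Function.update_of_ne hl]
    refine absurd (hy.sum_le (Function.update y (i + 1) z) ?_ ?_ ?_) (not_le.2 hlt)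
    · exact Function.update_of_ne (by omega) _ _
    · exact Function.update_of_ne (by omega) _ _
    · intro l hl
      by_cases h1 : l = i + 1
      · subst h1
        rw [Function.update_self, Function.update_of_ne (by omega)]
        exact hz'.symm
      · by_cases h2 : l = i
        · subst h2
          rw [Function.update_self, Function.update_of_ne (by omega)]
          exact hz
        · rw [Function.update_of_ne h1, Function.update_of_ne (by omega)]
          exact hy.adj l hl
  · obtain ⟨p, hp⟩ := exists_walk_of_adj hy.adj (Nat.zero_le i) (by omega)
    obtain ⟨q, hq⟩ := exists_walk_of_adj hy.adj hk le_rfl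
    have := hy.le_length (((p.concat hz).concat hz'.symm).append q)
    simp only [SimpleGraph.Walk.length_append, SimpleGraph.Walk.length_concat] at this
    omega

/-- The case where the coloring comes from an integer interval coloring. -/
lemma IsLocalNumbering.lt_card_of_trivial_loops (h : IsLocalNumbering G pos)
    (hconn : G.Connected) (htf : G.CliqueFree 3) {t : ℕ} [NeZero t] {κ : V → ZMod t}
    (hκ : ∀ v w, G.Adj v w → κ v + (pos v w : ZMod t) = κ w + (pos w v : ZMod t))
    (hsurj : ∀ x, ∃ v w, G.Adj v w ∧ κ v + (pos v w : ZMod t) = x)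
    (hloop : ∀ v a b, (liftGraph G pos).Reachable (v, a) (v, b) → a = b) :
    t < Fintype.card V := by
  classical
  have := hconn.nonempty
  let r := Classical.arbitrary V
  have hr : ∀ v, ∃ b, (liftGraph G pos).Reachable (r, 0) (v, b) := fun v =>
    exists_lift_walk (hconn.preconnected r v).some 0
  choose f hf using hr
  obtain ⟨u, hu⟩ := Finite.exists_min f
  obtain ⟨v, hv⟩ := Finite.exists_max fun v => f v + G.degree v
  have hcard : t ≤ (Finset.Ico (f u) (f v + G.degree v)).card := by
    have hs : Finset.univ ⊆ (Finset.Ico (f u) (f v + G.degree v)).image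
        (fun j : ℤ => (j : ZMod t) + κ r) := by
      intro x _
      obtain ⟨a, b, hab, rfl⟩ := hsurj x
      have h1 := h.nonneg a b hab
      have h2 := h.lt a b hab
      have h3 := hu a
      have h4 := hv a
      have h5 := walk_residue hκ (hf a).some
      refine Finset.mem_image.2 ⟨f a + pos a b, Finset.mem_Ico.2 ⟨by omega, by omega⟩, ?_⟩
      push_cast at h5 ⊢
      linear_combination -h5
    simpa [ZMod.card] using (Finset.card_le_card hs).trans Finset.card_image_le
  obtain ⟨p, hp⟩ := ((hf u).symm.trans (hf v)).exists_walk_length_eq_dist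
  obtain ⟨y, hy, h0, hk⟩ := h.exists_isOptimal p fun q => hp ▸ SimpleGraph.dist_le q
  have hex : ∀ j : ℤ, j ∈ Finset.Ico (f u) (f v + G.degree v) →
      ∃ i ≤ p.length, ∃ w, G.Adj (y i).1 w ∧ (y i).2 + pos (y i).1 w = j ∧
        ∀ l < i, top G (y l) ≤ j := fun j hj => by
    rw [Finset.mem_Ico] at hj
    exact h.exists_color hy.adj (by simpa [h0] using hj.1) (by rw [hk]; exact hj.2)
  choose! i hi w hw hc hnew using hex
  have hreach : ∀ j ∈ Finset.Ico (f u) (f v + G.degree v), ∀ j' ∈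
      Finset.Ico (f u) (f v + G.degree v), (liftGraph G pos).Reachable (y (i j)) (y (i j')) := by
    intro j hj j' hj'
    obtain ⟨q, -⟩ := exists_walk_of_adj hy.adj (Nat.zero_le _) (hi j hj)
    obtain ⟨q', -⟩ := exists_walk_of_adj hy.adj (Nat.zero_le _) (hi j' hj')
    exact q.reachable.symm.trans q'.reachable
  have hinj : Set.InjOn w (Finset.Ico (f u) (f v + G.degree v)) := by
    intro j hj j' hj' hww
    have hlt : ∀ a ∈ Finset.Ico (f u) (f v + G.degree v),
        ∀ b ∈ Finset.Ico (f u) (f v + G.degree v), w a = w b → ¬ i a < i b := by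
      intro a ha b hb hab hlt
      have ha1 := liftGraph_adj_lift (pos := pos) (y (i a)).2 (hw a ha)
      have hb1 := liftGraph_adj_lift (pos := pos) (y (i b)).2 (hw b hb)
      rw [← hab] at hb1
      have heq := hloop _ _ _
        ((ha1.reachable.symm.trans (hreach a ha b hb)).trans hb1.reachable)
      rw [← heq] at hb1
      refine hy.not_common_neighbor h htf hlt (hi b hb) ha1 hb1 fun l hl => ?_
      have := hc b hb
      rw [← hab] at this
      simpa [this] using hnew b hb l hl
    have hij : i j = i j' :=
      le_antisymm (not_lt.1 (hlt j' hj' j hj hww.symm)) (not_lt.1 (hlt j hj j' hj' hww))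
    rw [← hc j hj, ← hc j' hj', hij, hww]
  have hne : ∀ j ∈ Finset.Ico (f u) (f v + G.degree v), w j ≠ u := by
    intro j hj hju
    have h1 := liftGraph_adj_lift (pos := pos) (y (i j)).2 (hw j hj)
    have h2 := hc j hj
    rw [hju] at h1 h2
    obtain ⟨q, -⟩ := exists_walk_of_adj hy.adj (Nat.zero_le _) (hi j hj)
    rw [h0] at q
    have h3 := hloop _ _ _ (q.reachable.trans h1.reachable)
    rw [← h3] at h1
    rcases Nat.eq_zero_or_pos (i j) with h4 | h4
    · rw [h4, h0] at h1
      exact (liftGraph G pos).irrefl h1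
    · have h5 := hnew j hj 0 h4
      have h6 := h.color_lt_top h1.symm
      have h7 := h1.2
      rw [h0] at h5
      simp only at h6 h7
      omega
  have himg : (Finset.Ico (f u) (f v + G.degree v)).image w ⊆ Finset.univ.erase u := by
    intro x hx
    obtain ⟨j, hj, rfl⟩ := Finset.mem_image.1 hx
    simpa using hne j hj
  have h1 := Finset.card_le_card himg
  rw [Finset.card_image_of_injOn hinj, Finset.card_erase_of_mem (Finset.mem_univ _),
    Finset.card_univ] at h1
  have : 0 < Fintype.card V := Fintype.card_pos
  omega

/-- The case where some closed walk shifts the colors by a nonzero multiple of `t`. -/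
lemma IsLocalNumbering.le_card_add_maxDegree_of_loop (h : IsLocalNumbering G pos)
    (htf : G.CliqueFree 3) {t : ℕ} {κ : V → ZMod t} (hdeg : ∀ v, G.degree v ≤ t)
    (hκ : ∀ v w, G.Adj v w → κ v + (pos v w : ZMod t) = κ w + (pos w v : ZMod t))
    (hloop : ∃ v a b, (liftGraph G pos).Reachable (v, a) (v, b) ∧ a ≠ b) :
    t + 2 ≤ Fintype.card V + G.maxDegree := by
  classical
  have hdvd : ∀ {v a b}, (liftGraph G pos).Walk (v, a) (v, b) → (t : ℤ) ∣ b - a := by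
    intro v a b p
    have := walk_residue hκ p
    rw [← ZMod.intCast_eq_intCast_iff_dvd_sub]
    simpa using this
  have hsign : ∀ {n : ℕ} {v a b} (p : (liftGraph G pos).Walk (v, a) (v, b)), p.length = n →
      a ≠ b → ∃ (T : ℕ) (v : V) (a : ℤ) (p : (liftGraph G pos).Walk (v, a) (v, a + T)),
        0 < T ∧ p.length = n := by
    intro n v a b p hp hab
    rcases lt_or_gt_of_ne hab with hlt | hlt
    · obtain ⟨T, hT⟩ := Int.eq_ofNat_of_zero_le (sub_nonneg.2 hlt.le)
      obtain rfl : b = a + T := by omega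
      exact ⟨T, v, a, p, by omega, hp⟩
    · obtain ⟨T, hT⟩ := Int.eq_ofNat_of_zero_le (sub_nonneg.2 hlt.le)
      obtain rfl : a = b + T := by omega
      exact ⟨T, v, b, p.reverse, by omega, by simpa using hp⟩
  have hk : ∃ n, ∃ (T : ℕ) (v : V) (a : ℤ) (p : (liftGraph G pos).Walk (v, a) (v, a + T)),
      0 < T ∧ p.length = n := by
    obtain ⟨v, a, b, ⟨p⟩, hab⟩ := hloop
    exact ⟨_, hsign p rfl hab⟩
  obtain ⟨k, hT, hkmin⟩ : ∃ k, (∃ (T : ℕ) (v : V) (a : ℤ)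
      (p : (liftGraph G pos).Walk (v, a) (v, a + T)), 0 < T ∧ p.length = k) ∧
      ∀ {v a b} (p : (liftGraph G pos).Walk (v, a) (v, b)), a ≠ b → k ≤ p.length :=
    ⟨Nat.find hk, Nat.find_spec hk, fun p hab => Nat.find_min' hk (hsign p rfl hab)⟩
  obtain ⟨T, ⟨x, a, p, hT0, hpk⟩, hTmin⟩ : ∃ T : ℕ, (∃ (v : V) (a : ℤ)
      (p : (liftGraph G pos).Walk (v, a) (v, a + T)), 0 < T ∧ p.length = k) ∧
      ∀ {v a b} (p : (liftGraph G pos).Walk (v, a) (v, b)), p.length = k → a < b →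
        a + T ≤ b := by
    refine ⟨Nat.find hT, Nat.find_spec hT, fun {v a b} p hp hab => ?_⟩
    obtain ⟨S, hS⟩ := Int.eq_ofNat_of_zero_le (sub_nonneg.2 hab.le)
    obtain rfl : b = a + S := by omega
    have := Nat.find_min' hT ⟨v, a, p, by omega, hp⟩
    omega
  have htT : t ≤ T := by
    have := hdvd p
    simp only [add_sub_cancel_left, Int.natCast_dvd_natCast] at this
    exact Nat.le_of_dvd hT0 this
  obtain ⟨y, hy, h0, hyk⟩ := h.exists_isOptimal p fun q =>
    hpk ▸ hkmin q (by omega)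
  rw [hpk] at hy hyk
  clear hpk
  have hk3 : 3 ≤ k := by
    by_contra! hlt
    interval_cases k
    · rw [h0, Prod.mk.injEq] at hyk
      omega
    · have h1 := hy.adj 0 (by omega)
      rw [h0, hyk] at h1
      exact G.irrefl h1.1
    · have h1 := (hy.adj 0 (by omega)).2
      have h2 := (hy.adj 1 (by omega)).2
      simp only [zero_add, Nat.reduceAdd, h0, hyk] at h1 h2
      omega
  set J : Finset ℤ := Finset.Ico (top G (y 0)) (top G (y 0) + T) with hJ
  have hex : ∀ j : ℤ, j ∈ J →
      ∃ i ≤ k, ∃ w, G.Adj (y i).1 w ∧ (y i).2 + pos (y i).1 w = j ∧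
        ∀ l < i, top G (y l) ≤ j := fun j hj => by
    rw [hJ, Finset.mem_Ico] at hj
    refine h.exists_color hy.adj (le_trans (by simp [top]) hj.1) ?_
    have := hj.2
    rw [h0] at this
    rw [hyk]
    simp only [top] at this ⊢
    omega
  have : Nonempty V := ⟨x⟩
  choose! i hi w hw hc hnew using hex
  have hi1 : ∀ j ∈ J, 1 ≤ i j := by
    intro j hj
    by_contra! hlt
    have h1 := h.lt _ _ (hw j hj)
    have h2 := hc j hj
    have h3 := (Finset.mem_Ico.1 hj).1
    obtain h4 : i j = 0 := by omega
    rw [h4] at h1 h2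
    unfold top at h3
    omega
  have hconf : ∀ j ∈ J, ∀ j' ∈ J, w j = w j' → i j < i j' →
      i j = 1 ∧ i j' = k - 1 ∧ w j ≠ (y 2).1 := by
    intro j hj j' hj' hww hlt
    have hz := liftGraph_adj_lift (pos := pos) (y (i j)).2 (hw j hj)
    have hz' := liftGraph_adj_lift (pos := pos) (y (i j')).2 (hw j' hj')
    have hcj' := hc j' hj'
    have hcj := hc j hj
    have hij1 := hi1 j hj
    have hik := hi j' hj'
    have hwj := hw j hj
    have hwj' := hw j' hj'
    have hnj := hnew j hj
    have hnj' := hnew j' hj'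
    have hJj := Finset.mem_Ico.1 hj
    have hJj' := Finset.mem_Ico.1 hj'
    rw [← hww] at hz' hcj' hwj'
    generalize w j = u at *
    generalize i j = m at *
    generalize i j' = m' at *
    generalize hβ : (y m).2 + pos (y m).1 u - pos u (y m).1 = β at *
    generalize hβ' : (y m').2 + pos (y m').1 u - pos u (y m').1 = β' at *
    change (liftGraph G pos).Adj (y m) _ at hz
    change (liftGraph G pos).Adj (y m') _ at hz'
    by_cases hββ : β = β'
    · subst hββ
      exact (hy.not_common_neighbor h htf hlt hik hz hz' fun l hl => by
        simpa [hcj'] using hnj' l hl).elim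
    obtain ⟨q, hq⟩ := exists_walk_of_adj hy.adj hlt.le hik
    have hlen : ((q.concat hz').cons hz.symm).length = m' - m + 2 := by simp [hq]
    have hge := hkmin ((q.concat hz').cons hz.symm) hββ
    rw [hlen] at hge
    obtain ⟨rfl, rfl⟩ | ⟨rfl, rfl⟩ | ⟨rfl, rfl⟩ :
        m = 1 ∧ m' = k - 1 ∨ m = 1 ∧ m' = k ∨ m = 2 ∧ m' = k := by omega
    · refine ⟨rfl, rfl, ?_⟩
      rintro rfl
      have h12 := (hy.adj 1 (by omega)).2
      obtain ⟨q, hq⟩ := exists_walk_of_adj hy.adj (i := 2) (j := k - 1) (by omega) (by omega)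
      have h2 : y 2 = ((y 2).1, β) := by
        ext
        · rfl
        · simp only [Nat.reduceAdd] at h12 ⊢
          omega
      have hge := hkmin ((q.concat hz').copy h2 rfl) hββ
      simp only [SimpleGraph.Walk.length_copy, SimpleGraph.Walk.length_concat, hq] at hge
      omega
    · have h01 := (hy.adj 0 (by omega)).1
      rw [hyk] at hwj'
      rw [h0] at h01
      exact (htf _ (SimpleGraph.is3Clique_triple_iff.2 ⟨h01, hwj', hwj⟩)).elim
    · exfalso
      have hu0 : (liftGraph G pos).Adj (y 0) (u, β' - T) := by
        have h1 := hz'.2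
        refine ⟨by rw [h0]; rw [hyk] at hwj'; exact hwj', ?_⟩
        rw [hyk] at h1
        rw [h0]
        simp only at h1 ⊢
        omega
      have hne : β' - T ≠ β := by
        intro heq
        rw [heq] at hu0
        exact hy.not_common_neighbor h htf (by omega) (by omega) hu0 hz fun l hl => by
          simpa [hcj] using hnj l hl
      have hd := hdvd ((q.concat hz').cons hz.symm)
      have hdT := hdvd p
      simp only [add_sub_cancel_left] at hdT
      have h1 := h.nonneg _ _ hz.1.symm
      have h2 := h.lt _ _ hz.1.symm
      have h3 := h.nonneg _ _ hz'.1.symm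
      have h4 := h.lt _ _ hz'.1.symm
      have h5 := hdeg u
      have h6 := hz.2
      have h7 := hz'.2
      simp only at h1 h2 h3 h4 h6 h7
      have hjj : j < j' := lt_of_lt_of_le (by
        have := h.color_lt_top hz
        simp only at this
        omega) (hnj' 2 hlt)
      rcases lt_or_gt_of_ne hββ with hlt' | hlt'
      · have h8 := hTmin _ (hlen.trans (by omega)) hlt'
        have h9 := Int.le_of_dvd (by omega) (dvd_sub hd hdT)
        omega
      · have h9 := Int.le_of_dvd (by omega) (dvd_sub_comm.1 hd)
        omega
  have hsame : ∀ j ∈ J, ∀ j' ∈ J, w j = w j' → i j = i j' → j = j' := by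
    intro j hj j' hj' hww hij
    rw [← hc j hj, ← hc j' hj', hij, hww]
  set E : Finset ℤ := J.filter fun j' => i j' = k - 1 ∧ ∃ j ∈ J, w j = w j' ∧ i j < i j' with hE
  have hEcard : E.card ≤ (((G.neighborFinset (y 1).1).erase (y 0).1).erase (y 2).1).card := by
    refine Finset.card_le_card_of_injOn w ?_ ?_
    · intro j' hj'
      obtain ⟨hj', -, j, hj, hww, hlt⟩ := Finset.mem_filter.1 hj'
      obtain ⟨h1, -, h2⟩ := hconf j hj j' hj' hww hlt
      have h3 := hw j hj
      rw [h1] at h3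
      rw [← hww]
      simp only [Finset.coe_erase, Set.mem_sdiff, Finset.mem_coe, SimpleGraph.mem_neighborFinset,
        Set.mem_singleton_iff]
      refine ⟨⟨h3, fun h4 => ?_⟩, h2⟩
      have h5 := hc j hj
      have h6 := hnew j hj 0 (by omega)
      have h7 := hy.adj 0 (by omega)
      have h8 := h.color_lt_top h7
      have h9 := h7.2
      rw [h1, h4] at h5
      simp only [zero_add] at h8 h9
      omega
    · intro j hj j' hj' hww
      have h1 := Finset.mem_filter.1 hj
      have h2 := Finset.mem_filter.1 hj'
      exact hsame j h1.1 j' h2.1 hww (h1.2.1.trans h2.2.1.symm)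
  have hJE : (J \ E).card ≤ Fintype.card V := by
    rw [← Finset.card_univ]
    refine Finset.card_le_card_of_injOn w (fun _ _ => by simp) ?_
    have key : ∀ j ∈ J, ∀ j' ∈ J \ E, w j = w j' → ¬ i j < i j' := by
      intro j hj j' hj' hww hlt
      rw [Finset.mem_sdiff] at hj'
      exact hj'.2 (Finset.mem_filter.2
        ⟨hj'.1, (hconf j hj j' hj'.1 hww hlt).2.1, j, hj, hww, hlt⟩)
    intro j hj j' hj' hww
    have h1 := Finset.mem_sdiff.1 hj
    have h2 := Finset.mem_sdiff.1 hj'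
    exact hsame j h1.1 j' h2.1 hww (le_antisymm
      (not_lt.1 (key j' h2.1 j hj hww.symm)) (not_lt.1 (key j h1.1 j' hj' hww)))
  have h01 := hy.adj 0 (by omega)
  have h12 := hy.adj 1 (by omega)
  have hne : (y 2).1 ≠ (y 0).1 := by
    intro heq
    have h2 := h01.2
    have h3 := h12.2
    simp only [zero_add, Nat.reduceAdd] at h2 h3
    rw [heq] at h3
    have h4 : y 2 = y 0 := Prod.ext heq (by omega)
    obtain ⟨q, hq⟩ := exists_walk_of_adj hy.adj (i := 2) (j := k) (by omega) le_rfl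
    have := hy.le_length (q.copy h4 rfl)
    simp only [SimpleGraph.Walk.length_copy, hq] at this
    omega
  have hm0 : (y 0).1 ∈ G.neighborFinset (y 1).1 := by
    simpa using h01.1.symm
  have hm2 : (y 2).1 ∈ (G.neighborFinset (y 1).1).erase (y 0).1 := by
    simpa using ⟨hne, h12.1⟩
  rw [Finset.card_erase_of_mem hm2, Finset.card_erase_of_mem hm0,
    SimpleGraph.card_neighborFinset_eq_degree] at hEcard
  have hpos : 2 ≤ G.degree (y 1).1 := by
    have h1 := Finset.card_pos.2 ⟨_, hm2⟩
    rw [Finset.card_erase_of_mem hm0, SimpleGraph.card_neighborFinset_eq_degree] at h1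
    omega
  have hJcard : J.card = T := by simp [hJ]
  have hsum : (J \ E).card + E.card = J.card :=
    Finset.card_sdiff_add_card_eq_card (Finset.filter_subset _ J)
  have hmax := G.degree_le_maxDegree (y 1).1
  omega

/-- An interval cyclic coloring numbers the edges at each vertex consecutively. -/
lemma IsIntervalCyclicColoring.exists_isLocalNumbering {t : ℕ} {c : Sym2 V → ZMod t}
    (hc : IsIntervalCyclicColoring G t c) :
    ∃ (pos : V → V → ℤ) (κ : V → ZMod t), IsLocalNumbering G pos ∧
      ∀ v w, G.Adj v w → c s(v, w) = κ v + (pos v w : ZMod t) := by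
  obtain ⟨hproper, -, hint⟩ := hc
  choose κ hκ using hint
  have hex : ∀ v w, G.Adj v w → ∃ n : ℕ, n < G.degree v ∧ c s(v, w) = κ v + (n : ZMod t) := by
    intro v w hvw
    have h1 := (Finset.ext_iff.1 (hκ v) (c s(v, w))).1
      (Finset.mem_image.2 ⟨w, by simpa using hvw, rfl⟩)
    simp only [Finset.mem_image, Finset.bind_def, Finset.mem_sup, Finset.mem_range,
      Finset.pure_def, Finset.mem_singleton] at h1
    obtain ⟨_, ⟨n, hn, rfl⟩, h2⟩ := h1
    exact ⟨n, by convert hn, h2.symm⟩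
  choose! pos hlt heq using hex
  have hinj : ∀ v w w', G.Adj v w → G.Adj v w' → pos v w = pos v w' → w = w' := by
    intro v w w' h1 h2 h3
    by_contra hne
    exact hproper v w w' h1 h2 hne (by rw [heq v w h1, heq v w' h2, h3])
  refine ⟨fun v w => pos v w, κ, ⟨fun _ _ _ => by positivity,
    fun v w hvw => by exact_mod_cast hlt v w hvw,
    fun v w w' h1 h2 h3 => hinj v w w' h1 h2 (by exact_mod_cast h3), ?_⟩,
    fun v w hvw => by simpa using heq v w hvw⟩
  intro v j hj0 hj
  lift j to ℕ using hj0
  have himg : (G.neighborFinset v).image (pos v) = Finset.range (G.degree v) := by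
    refine Finset.eq_of_subset_of_card_le ?_ ?_
    · intro n hn
      obtain ⟨w, hw, rfl⟩ := Finset.mem_image.1 hn
      exact Finset.mem_range.2 (hlt v w ((G.mem_neighborFinset v w).1 hw))
    · rw [Finset.card_image_of_injOn, Finset.card_range, SimpleGraph.card_neighborFinset_eq_degree]
      intro w hw w' hw' h
      exact hinj v w w' (by simpa using hw) (by simpa using hw') h
  have hmem : j ∈ (G.neighborFinset v).image (pos v) := by
    rw [himg]
    exact Finset.mem_range.2 (by exact_mod_cast hj)
  obtain ⟨w, hw, h⟩ := Finset.mem_image.1 hmem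
  exact ⟨w, by simpa using hw, by exact_mod_cast h⟩

lemma IsIntervalCyclicColoring.degree_le {t : ℕ} [NeZero t] {c : Sym2 V → ZMod t}
    (hc : IsIntervalCyclicColoring G t c) (v : V) : G.degree v ≤ t := by
  rw [← SimpleGraph.card_neighborFinset_eq_degree, ← ZMod.card t, ← Finset.card_univ]
  refine Finset.card_le_card_of_injOn (fun w => c s(v, w)) (fun _ _ => by simp) ?_
  intro w hw w' hw' h
  by_contra hne
  exact hc.1 v w w' (by simpa using hw) (by simpa using hw') hne h

lemma HasIntervalCyclicColoring.add_two_le (hconn : G.Connected) (htf : G.CliqueFree 3)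
    (hcard : 2 ≤ Fintype.card V) {t : ℕ} (ht : HasIntervalCyclicColoring G t) :
    t + 2 ≤ Fintype.card V + G.maxDegree := by
  obtain ⟨ht0, c, hc⟩ := ht
  have : NeZero t := ⟨ht0.ne'⟩
  obtain ⟨pos, κ, h, hcκ⟩ := hc.exists_isLocalNumbering
  have hκ : ∀ v w, G.Adj v w → κ v + (pos v w : ZMod t) = κ w + (pos w v : ZMod t) := by
    intro v w hvw
    rw [← hcκ v w hvw, ← hcκ w v hvw.symm, Sym2.eq_swap]
  by_cases hloop : ∃ v a b, (liftGraph G pos).Reachable (v, a) (v, b) ∧ a ≠ b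
  · exact h.le_card_add_maxDegree_of_loop htf hc.degree_le hκ hloop
  · have hsurj : ∀ x, ∃ v w, G.Adj v w ∧ κ v + (pos v w : ZMod t) = x := by
      intro x
      obtain ⟨e, he, rfl⟩ := hc.2.1 x
      induction e with
      | h v w => exact ⟨v, w, he, (hcκ v w he).symm⟩
    have h1 := h.lt_card_of_trivial_loops hconn htf hκ hsurj fun v a b hab => by
      by_contra hne
      exact hloop ⟨v, a, b, hab, hne⟩
    have : Nontrivial V := Fintype.one_lt_card_iff_nontrivial.1 hcard
    have h2 := hconn.preconnected.degree_pos_of_nontrivial (Classical.arbitrary V)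
    have h3 := G.degree_le_maxDegree (Classical.arbitrary V)
    omega

end

/-- If `G` is a connected triangle-free finite simple graph with at
least two vertices that is interval cyclically colorable, then
`W_c(G) ≤ |V(G)| + Δ(G) − 2`; equivalently, every interval cyclic `t`-coloring of
such a graph satisfies `t ≤ |V(G)| + Δ(G) − 2`. -/
theorem stmt_0 {V : Type*} [Fintype V] (G : SimpleGraph V) [DecidableRel G.Adj]
    (hconn : G.Connected) (htf : G.CliqueFree 3) (hcard : 2 ≤ Fintype.card V)
    (hNc : ∃ t, HasIntervalCyclicColoring G t) :
    Wc G ≤ Fintype.card V + G.maxDegree - 2 ∧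
      ∀ t, HasIntervalCyclicColoring G t → t ≤ Fintype.card V + G.maxDegree - 2 := by
  have key : ∀ t, HasIntervalCyclicColoring G t → t ≤ Fintype.card V + G.maxDegree - 2 :=
    fun t ht => Nat.le_sub_of_add_le (ht.add_two_le hconn htf hcard)
  exact ⟨csSup_le hNc key, key⟩

end IntervalCyclic
end

section
/- If G is a connected triangle-free finite simple graph with at least two vertices and G ∈ N_c, then W_c(G) ≤ 2|V(G)| − 3; moreover, if G has at least three vertices, then W_c(G) ≤ 2|V(G)| − 4. -/
attribute [local instance] Classical.propDecidable

namespace IntervalCyclic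

variable {V : Type*}

/-- The sum of `a` over the darts of a walk. -/
def walkSum {G : SimpleGraph V} (a : V → V → ℤ) {u v : V} (p : G.Walk u v) : ℤ :=
  (p.darts.map fun d => a d.fst d.snd).sum

section WalkSum

variable {G : SimpleGraph V} {a : V → V → ℤ} {u v w : V}

@[simp] lemma walkSum_nil : walkSum a (SimpleGraph.Walk.nil : G.Walk u u) = 0 := by
  simp [walkSum]

@[simp] lemma walkSum_cons (h : G.Adj u v) (p : G.Walk v w) :
    walkSum a (SimpleGraph.Walk.cons h p) = a u v + walkSum a p := by
  simp [walkSum]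

@[simp] lemma walkSum_append (p : G.Walk u v) (q : G.Walk v w) :
    walkSum a (p.append q) = walkSum a p + walkSum a q := by
  simp [walkSum]

lemma walkSum_reverse (ha : ∀ x y, a y x = -a x y) (p : G.Walk u v) :
    walkSum a p.reverse = -walkSum a p := by
  induction p with
  | nil => simp
  | cons h p ih =>
    rw [SimpleGraph.Walk.reverse_cons, walkSum_append, ih, walkSum_cons, walkSum_cons, walkSum_nil,
      ha]
    ring

lemma walkSum_eq_sum_range (p : G.Walk u v) :
    walkSum a p = ∑ i ∈ Finset.range p.length, a (p.getVert i) (p.getVert (i + 1)) := by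
  induction p with
  | nil => simp
  | cons h p ih => simp [Finset.sum_range_succ', ih, add_comm (a _ _)]

lemma exists_segment (p : G.Walk u v) {i j : ℕ} (hij : i ≤ j) (hj : j ≤ p.length) :
    ∃ q : G.Walk (p.getVert i) (p.getVert j), q.length = j - i ∧
      walkSum a q = ∑ x ∈ Finset.Ico i j, a (p.getVert x) (p.getVert (x + 1)) := by
  induction j, hij using Nat.le_induction with
  | base => exact ⟨.nil, by simp, by simp⟩
  | succ j hij ih =>
    obtain ⟨q, hq, hs⟩ := ih (by omega)
    refine ⟨q.append (p.adj_getVert_succ (by omega)).toWalk, ?_, ?_⟩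
    · simp only [SimpleGraph.Walk.length_append, hq, SimpleGraph.Walk.length_cons,
        SimpleGraph.Walk.length_nil]
      omega
    · simp [hs, Finset.sum_Ico_succ_top hij]

end WalkSum

lemma not_adj_of_cliqueFree {G : SimpleGraph V} (htf : G.CliqueFree 3) {x y z : V}
    (hxy : G.Adj x y) (hxz : G.Adj x z) : ¬ G.Adj y z := fun hyz =>
  htf {x, y, z} (SimpleGraph.is3Clique_triple_iff.2 ⟨hxy, hxz, hyz⟩)

lemma exists_lt_lt_of_two_lt_card {s : Finset ℕ} (h : 2 < s.card) :
    ∃ i ∈ s, ∃ j ∈ s, ∃ l ∈ s, i < j ∧ j < l := by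
  obtain ⟨a, ha, b, hb, c, hc, hab, hac, hbc⟩ := Finset.two_lt_card.1 h
  rcases hab.lt_or_gt with h1 | h1 <;> rcases hac.lt_or_gt with h2 | h2 <;>
    rcases hbc.lt_or_gt with h3 | h3
  · exact ⟨a, ha, b, hb, c, hc, h1, h3⟩
  · exact ⟨a, ha, c, hc, b, hb, h2, h3⟩
  · omega
  · exact ⟨c, hc, a, ha, b, hb, h2, h1⟩
  · exact ⟨b, hb, a, ha, c, hc, h1, h2⟩
  · omega
  · exact ⟨b, hb, c, hc, a, ha, h3, h2⟩
  · exact ⟨c, hc, b, hb, a, ha, h3, h1⟩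

section TriangleFree

variable {G : SimpleGraph V}

/-- A vertex of a triangle-free graph has at most two neighbors on a closed walk of nonzero sum
that is shortest with this property. -/
lemma card_adj_closed_walk_le_two (htf : G.CliqueFree 3) {a : V → V → ℤ}
    (ha : ∀ x y, a y x = -a x y) {u : V} (p : G.Walk u u) (hp : walkSum a p ≠ 0)
    (hmin : ∀ (v : V) (q : G.Walk v v), q.length < p.length → walkSum a q = 0) (w : V) :
    ((Finset.range p.length).filter fun i => G.Adj w (p.getVert i)).card ≤ 2 := by
  by_contra! hcon
  obtain ⟨i, hi, j, hj, l, hl, hij, hjl⟩ := exists_lt_lt_of_two_lt_card hcon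
  simp only [Finset.mem_filter, Finset.mem_range] at hi hj hl
  obtain ⟨-, hwi⟩ := hi
  obtain ⟨-, hwj⟩ := hj
  obtain ⟨hlk, hwl⟩ := hl
  have detour : ∀ {x y : V} (q : G.Walk x y), G.Adj w x → G.Adj w y → q.length + 2 < p.length →
      walkSum a q = a w y - a w x := by
    intro x y q hx hy hq
    have h := hmin w ((SimpleGraph.Walk.cons hx q).append hy.symm.toWalk) (by simpa using hq)
    simp only [walkSum_append, walkSum_cons, walkSum_nil] at h
    rw [ha w y] at h
    linarith
  have gap : ∀ {x y : V} (q : G.Walk x y), G.Adj w x → G.Adj w y → q.length ≠ 1 :=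
    fun q hx hy hq => not_adj_of_cliqueFree htf hx hy (SimpleGraph.Walk.adj_of_length_eq_one hq)
  obtain ⟨A, hA, sA⟩ := exists_segment (a := a) p (Nat.zero_le i) (by omega)
  obtain ⟨B, hB, sB⟩ := exists_segment (a := a) p hij.le (by omega)
  obtain ⟨C, hC, sC⟩ := exists_segment (a := a) p hjl.le (by omega)
  obtain ⟨D, hD, sD⟩ := exists_segment (a := a) p hlk.le le_rfl
  set E := (D.copy rfl p.getVert_length).append (A.copy p.getVert_zero rfl) with hE
  have lE : E.length = p.length - l + i := by simp [hE, hA, hD]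
  have sE : walkSum a E = walkSum a D + walkSum a A := by simp [hE, walkSum]
  have gB := gap B hwi hwj
  have gC := gap C hwj hwl
  have gE := gap E hwl hwi
  have dB := detour B hwi hwj (by omega)
  have dC := detour C hwj hwl (by omega)
  have dE := detour E hwl hwi (by omega)
  apply hp
  rw [walkSum_eq_sum_range, Finset.range_eq_Ico,
    ← Finset.sum_Ico_consecutive _ (Nat.zero_le l) hlk.le,
    ← Finset.sum_Ico_consecutive _ (Nat.zero_le j) hjl.le,
    ← Finset.sum_Ico_consecutive _ (Nat.zero_le i) hij.le]
  linarith

lemma four_le_length_of_walkSum_ne_zero (htf : G.CliqueFree 3) {a : V → V → ℤ}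
    (ha : ∀ x y, a y x = -a x y) {u : V} (p : G.Walk u u) (hp : walkSum a p ≠ 0) :
    4 ≤ p.length := by
  match p, hp with
  | .nil, hp => simp at hp
  | .cons h .nil, hp => exact (h.ne rfl).elim
  | .cons (v := v) h (.cons h' .nil), hp => simp [ha u v] at hp
  | .cons h (.cons h' (.cons h'' .nil)), hp =>
    exact (not_adj_of_cliqueFree htf h h''.symm h').elim
  | .cons _ (.cons _ (.cons _ (.cons _ p))), hp => simp

/-- A vertex of a triangle-free graph has at most two neighbors on a shortest walk. -/
lemma card_adj_shortest_walk_le_two (htf : G.CliqueFree 3) {x y : V} (p : G.Walk x y)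
    (hp : p.length = G.dist x y) (w : V) :
    ((Finset.range (p.length + 1)).filter fun i => G.Adj w (p.getVert i)).card ≤ 2 := by
  by_contra! hcon
  obtain ⟨i, hi, j, hj, l, hl, hij, hjl⟩ := exists_lt_lt_of_two_lt_card hcon
  simp only [Finset.mem_filter, Finset.mem_range] at hi hj hl
  have h := SimpleGraph.dist_le ((p.take i).append
    (.cons hi.2.symm (.cons hl.2 (p.drop l))))
  simp only [SimpleGraph.Walk.length_append, SimpleGraph.Walk.length_cons,
    SimpleGraph.Walk.take_length, SimpleGraph.Walk.drop_length] at h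
  obtain rfl : j = i + 1 := by omega
  exact not_adj_of_cliqueFree htf hi.2 hj.2 (p.adj_getVert_succ (by omega))

/-- A vertex that is not closer to the end of a shortest walk than its start has at most one
neighbor on that walk. -/
lemma card_adj_shortest_walk_le_one (htf : G.CliqueFree 3) {x y : V} (p : G.Walk x y)
    (hp : p.length = G.dist x y) {w : V} (hw : G.dist x y ≤ G.dist w y) :
    ((Finset.range (p.length + 1)).filter fun i => G.Adj w (p.getVert i)).card ≤ 1 := by
  refine Finset.card_le_one.2 ?_
  have key : ∀ i ∈ (Finset.range (p.length + 1)).filter fun i => G.Adj w (p.getVert i),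
      i ≤ 1 := by
    intro i hi
    simp only [Finset.mem_filter, Finset.mem_range] at hi
    have h := SimpleGraph.dist_le (SimpleGraph.Walk.cons hi.2 (p.drop i))
    simp only [SimpleGraph.Walk.length_cons, SimpleGraph.Walk.drop_length] at h
    omega
  have not_both : ∀ i ∈ (Finset.range (p.length + 1)).filter fun i => G.Adj w (p.getVert i),
      ∀ j ∈ (Finset.range (p.length + 1)).filter fun i => G.Adj w (p.getVert i),
      ¬ j = i + 1 := by
    rintro i hi j hj rfl
    simp only [Finset.mem_filter, Finset.mem_range] at hi hj
    exact not_adj_of_cliqueFree htf hi.2 hj.2 (p.adj_getVert_succ (by omega))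
  intro i hi j hj
  have h1 := key i hi
  have h2 := key j hj
  have h3 := not_both i hi j hj
  have h4 := not_both j hj i hi
  omega

/-- The last vertex of a shortest walk has at most one neighbor on that walk. -/
lemma card_adj_shortest_walk_end_le_one {x y : V} (p : G.Walk x y)
    (hp : p.length = G.dist x y) :
    ((Finset.range (p.length + 1)).filter fun i => G.Adj y (p.getVert i)).card ≤ 1 := by
  have key : ∀ i ∈ (Finset.range (p.length + 1)).filter fun i => G.Adj y (p.getVert i),
      i + 1 = p.length := by
    intro i hi
    simp only [Finset.mem_filter, Finset.mem_range] at hi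
    have h := SimpleGraph.dist_le ((p.take i).append hi.2.symm.toWalk)
    simp only [SimpleGraph.Walk.length_append, SimpleGraph.Walk.length_cons,
      SimpleGraph.Walk.length_nil, SimpleGraph.Walk.take_length] at h
    have : i ≠ p.length := by
      rintro rfl
      simp at hi
    omega
  refine Finset.card_le_one.2 fun i hi j hj => ?_
  have h1 := key i hi
  have h2 := key j hj
  omega

end TriangleFree

section Finite

variable [Fintype V] {G : SimpleGraph V}

lemma sum_degree_eq_sum_card (G : SimpleGraph V) (f : ℕ → V) (k : ℕ) :
    ∑ i ∈ Finset.range k, G.degree (f i) =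
      ∑ w : V, ((Finset.range k).filter fun i => G.Adj w (f i)).card := by
  simp_rw [← SimpleGraph.card_neighborFinset_eq_degree, SimpleGraph.neighborFinset_eq_filter,
    Finset.card_filter]
  rw [Finset.sum_comm]
  simp_rw [G.adj_comm]

lemma walkSum_add_length_le {P : V → V → ℕ} (hP : ∀ u v, G.Adj u v → P u v < G.degree u)
    {u v : V} (p : G.Walk u v) :
    walkSum (fun u v => (P u v : ℤ) - P v u) p + p.length ≤
      ∑ i ∈ Finset.range p.length, (G.degree (p.getVert i) : ℤ) := by
  have hlen : (p.length : ℤ) = ∑ i ∈ Finset.range p.length, 1 := by simp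
  rw [walkSum_eq_sum_range, hlen, ← Finset.sum_add_distrib]
  refine Finset.sum_le_sum fun i hi => ?_
  have := hP _ _ (p.adj_getVert_succ (Finset.mem_range.1 hi))
  omega

lemma sum_degree_closed_walk_le (htf : G.CliqueFree 3) {a : V → V → ℤ}
    (ha : ∀ x y, a y x = -a x y) {u : V} (p : G.Walk u u) (hp : walkSum a p ≠ 0)
    (hmin : ∀ (v : V) (q : G.Walk v v), q.length < p.length → walkSum a q = 0) :
    ∑ i ∈ Finset.range p.length, G.degree (p.getVert i) ≤ 2 * Fintype.card V := by
  rw [sum_degree_eq_sum_card]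
  refine (Finset.sum_le_card_nsmul _ _ 2 fun w _ =>
    card_adj_closed_walk_le_two htf ha p hp hmin w).trans ?_
  simp [mul_comm]

/-- If some closed walk has nonzero sum and all sums of closed walks are divisible by `t`, then
`t` is at most `2 * |V| - 4`. -/
lemma add_four_le_of_walkSum_ne_zero (htf : G.CliqueFree 3) {P : V → V → ℕ}
    (hP : ∀ u v, G.Adj u v → P u v < G.degree u) {t : ℕ}
    (hdvd : ∀ (v : V) (q : G.Walk v v), (t : ℤ) ∣ walkSum (fun u v => (P u v : ℤ) - P v u) q)
    (hne : ∃ (v : V) (q : G.Walk v v), walkSum (fun u v => (P u v : ℤ) - P v u) q ≠ 0) :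
    t + 4 ≤ 2 * Fintype.card V := by
  set a : V → V → ℤ := fun u v => (P u v : ℤ) - P v u with ha_def
  have ha : ∀ x y, a y x = -a x y := fun x y => by simp [ha_def]
  have hex : ∃ k, ∃ (v : V) (q : G.Walk v v), walkSum a q ≠ 0 ∧ q.length = k := by
    obtain ⟨v, q, hq⟩ := hne
    exact ⟨_, v, q, hq, rfl⟩
  obtain ⟨v, q, hq, hlen⟩ := Nat.find_spec hex
  have hmin : ∀ (v' : V) (q' : G.Walk v' v'), q'.length < q.length → walkSum a q' = 0 := by
    intro v' q' h
    by_contra h0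
    exact Nat.find_min hex (hlen ▸ h) ⟨v', q', h0, rfl⟩
  obtain ⟨p, hpos, hpmin⟩ : ∃ p : G.Walk v v, 0 < walkSum a p ∧ ∀ (v' : V) (q' : G.Walk v' v'),
      q'.length < p.length → walkSum a q' = 0 := by
    rcases hq.lt_or_gt with h | h
    · exact ⟨q.reverse, by rw [walkSum_reverse ha]; omega, by simpa using hmin⟩
    · exact ⟨q, h, hmin⟩
  have h1 := Int.le_of_dvd hpos (hdvd v p)
  have h2 := walkSum_add_length_le hP p
  have h3 := sum_degree_closed_walk_le htf ha p hpos.ne' hpmin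
  have h4 := four_le_length_of_walkSum_ne_zero htf ha p hpos.ne'
  zify at h3 h4 ⊢
  linarith

lemma sum_degree_shortest_walk_add_three_le (htf : G.CliqueFree 3) {x x' y : V}
    (hxx' : G.Adj x x') (hxy : x ≠ y) (hle : G.dist x y ≤ G.dist x' y) (p : G.Walk x y)
    (hp : p.length = G.dist x y) :
    ∑ i ∈ Finset.range (p.length + 1), G.degree (p.getVert i) + 3 ≤ 2 * Fintype.card V := by
  have hx'y : x' ≠ y := by
    rintro rfl
    rw [SimpleGraph.dist_self, ← hp] at hle
    exact hxy (SimpleGraph.Walk.eq_of_length_eq_zero (Nat.le_zero.1 hle))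
  have hcard : ({x, x', y} : Finset V).card = 3 :=
    Finset.card_eq_three.2 ⟨x, x', y, hxx'.ne, hxy, hx'y, rfl⟩
  have hsub : ∑ w : V, (if w ∈ ({x, x', y} : Finset V) then 1 else 0) = 3 := by
    rw [← hcard, Finset.card_eq_sum_ones, Finset.sum_ite_mem, Finset.univ_inter]
  rw [sum_degree_eq_sum_card, ← hsub, ← Finset.sum_add_distrib]
  refine (Finset.sum_le_card_nsmul _ _ 2 fun w _ => ?_).trans (by simp [mul_comm])
  split_ifs with hw
  · refine Nat.succ_le_succ ?_
    simp only [Finset.mem_insert, Finset.mem_singleton] at hw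
    rcases hw with rfl | rfl | rfl
    · exact card_adj_shortest_walk_le_one htf p hp le_rfl
    · exact card_adj_shortest_walk_le_one htf p hp hle
    · exact card_adj_shortest_walk_end_le_one p hp
  · exact card_adj_shortest_walk_le_two htf p hp w

/-- If the differences of `P` come from a potential `h`, two lifted edge colors differ by less than
`|V| - 1` or by at most `2 * |V| - 5`. -/
lemma lift_sub_lift_le (hconn : G.Connected) (htf : G.CliqueFree 3) {P : V → V → ℕ}
    (hP : ∀ u v, G.Adj u v → P u v < G.degree u) {h : V → ℤ}
    (hh : ∀ (u v : V) (q : G.Walk u v),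
      walkSum (fun u v => (P u v : ℤ) - P v u) q = h v - h u)
    {x x' y y' : V} (hx : G.Adj x x') (hy : G.Adj y y') :
    h y + P y y' - (h x + P x x') + 2 ≤ Fintype.card V ∨
      h y + P y y' - (h x + P x x') + 5 ≤ 2 * Fintype.card V := by
  wlog hle : G.dist x y ≤ G.dist x' y generalizing x x'
  · have h1 := this hx.symm (by omega)
    have h2 := hh _ _ hx.toWalk
    simp only [walkSum_cons, walkSum_nil] at h2
    have h3 : h x' + P x' x = h x + P x x' := by linarith
    rwa [h3] at h1
  have hPy := hP _ _ hy
  rcases eq_or_ne x y with rfl | hxy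
  · have := G.degree_lt_card_verts x
    left
    omega
  · right
    obtain ⟨p, hp⟩ := hconn.exists_walk_length_eq_dist x y
    have hpos := hconn.pos_dist_of_ne hxy
    have h1 := hh _ _ p
    have h2 := walkSum_add_length_le hP p
    have h3 := sum_degree_shortest_walk_add_three_le htf hx hxy hle p hp
    rw [Finset.sum_range_succ, p.getVert_length] at h3
    zify at h3 hPy
    omega

lemma colors_le (hconn : G.Connected) (htf : G.CliqueFree 3) {t : ℕ}
    (ht : HasIntervalCyclicColoring G t) :
    t + 1 ≤ Fintype.card V ∨ t + 4 ≤ 2 * Fintype.card V := by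
  obtain ⟨ht0, c, -, hsurj, hint⟩ := ht
  have : NeZero t := ⟨ht0.ne'⟩
  choose k hk using hint
  have hpos : ∀ u v, ∃ i : ℕ, G.Adj u v → i < G.degree u ∧ c s(u, v) = k u + i := by
    intro u v
    by_cases huv : G.Adj u v
    · have : c s(u, v) ∈ (G.neighborFinset u).image (fun w => c s(u, w)) :=
        Finset.mem_image_of_mem _ (by simpa using huv)
      rw [hk u] at this
      simp only [Finset.bind_def, Finset.pure_def, Finset.mem_image, Finset.mem_sup,
        Finset.mem_range, Finset.mem_singleton] at this
      obtain ⟨_, ⟨i, hi, rfl⟩, hi'⟩ := this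
      exact ⟨i, fun _ => ⟨hi, hi'.symm⟩⟩
    · exact ⟨0, fun h => (huv h).elim⟩
  choose P hP using hpos
  have hPlt : ∀ u v, G.Adj u v → P u v < G.degree u := fun u v huv => (hP u v huv).1
  set a : V → V → ℤ := fun u v => (P u v : ℤ) - P v u with ha_def
  have ha : ∀ x y, a y x = -a x y := fun x y => by simp [ha_def]
  have hcast : ∀ (u v : V) (q : G.Walk u v), ((walkSum a q : ℤ) : ZMod t) = k v - k u := by
    intro u v q
    induction q with
    | nil => simp
    | @cons u v w huv q ih =>
      have h1 := (hP u v huv).2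
      have h2 := (hP v u huv.symm).2
      rw [Sym2.eq_swap, h1] at h2
      simp only [walkSum_cons, Int.cast_add, ih, a, Int.cast_sub, Int.cast_natCast]
      linear_combination h2
  by_cases hne : ∃ (v : V) (q : G.Walk v v), walkSum a q ≠ 0
  · refine .inr (add_four_le_of_walkSum_ne_zero htf hPlt (fun v q => ?_) hne)
    rw [← ZMod.intCast_zmod_eq_zero_iff_dvd]
    simpa using hcast v v q
  push Not at hne
  obtain ⟨r⟩ := hconn.nonempty
  choose W _ using fun v => (hconn r v).exists_isPath
  set h : V → ℤ := fun v => walkSum a (W v) with h_def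
  have hh : ∀ (u v : V) (q : G.Walk u v), walkSum a q = h v - h u := by
    intro u v q
    have := hne r (((W u).append q).append (W v).reverse)
    rw [walkSum_append, walkSum_append, walkSum_reverse ha] at this
    simp only [h_def]
    linarith
  let L : G.Dart → ℤ := fun d => h d.fst + P d.fst d.snd
  have hL : ∀ z : ZMod t, ∃ d, (L d : ZMod t) = z := by
    intro z
    obtain ⟨e, he, hez⟩ := hsurj (z + k r)
    induction e with
    | _ u v =>
      refine ⟨⟨(u, v), he⟩, ?_⟩
      have h1 := (hP u v he).2
      simp only [L, h_def, Int.cast_add, hcast, Int.cast_natCast]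
      linear_combination hez - h1
  obtain ⟨d₀, -⟩ := hL 0
  obtain ⟨m, -, hm⟩ := Finset.exists_min_image Finset.univ L ⟨d₀, Finset.mem_univ _⟩
  obtain ⟨M, -, hM⟩ := Finset.exists_max_image Finset.univ L ⟨d₀, Finset.mem_univ _⟩
  have hcardt : t ≤ (L M + 1 - L m).toNat := by
    rw [← Int.card_Icc]
    conv_lhs => rw [← ZMod.card t, ← Finset.card_univ]
    refine Finset.card_le_card_of_surjOn (fun z : ℤ => (z : ZMod t)) fun z _ => ?_
    obtain ⟨d, hd⟩ := hL z
    exact ⟨L d, by simp [hm d, hM d], hd⟩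
  have := lift_sub_lift_le hconn htf hPlt hh m.adj M.adj
  have hmM := hm M (Finset.mem_univ _)
  simp only [L] at hcardt hmM
  omega

end Finite

/-- If `G` is a connected triangle-free finite simple graph with at
least two vertices and `G ∈ N_c`, then `W_c(G) ≤ 2|V(G)| − 3`; moreover, if `G` has
at least three vertices, then `W_c(G) ≤ 2|V(G)| − 4`. -/
theorem stmt_1 {V : Type*} [Fintype V] (G : SimpleGraph V)
    (hconn : G.Connected) (htf : G.CliqueFree 3) (hcard : 2 ≤ Fintype.card V)
    (hNc : ∃ t, HasIntervalCyclicColoring G t) :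
    Wc G ≤ 2 * Fintype.card V - 3 ∧
      (3 ≤ Fintype.card V → Wc G ≤ 2 * Fintype.card V - 4) := by
  have hbound : ∀ t ∈ {t | HasIntervalCyclicColoring G t}, t + 1 ≤ Fintype.card V ∨
      t + 4 ≤ 2 * Fintype.card V := fun t ht => colors_le hconn htf ht
  refine ⟨csSup_le hNc fun t ht => ?_, fun h3 => csSup_le hNc fun t ht => ?_⟩ <;>
  · have := hbound t ht
    omega

end IntervalCyclic
end

section
/- If G is a connected finite simple graph and G ∈ N_c, then W_c(G) ≤ 1 + 2·max over all shortest paths P in G of the sum over vertices v of P of (d_G(v) − 1). Here a shortest path is a path whose length equals the distance between its endpoints, and the maximum is taken over all shortest paths in G. -/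
attribute [local instance] Classical.propDecidable

namespace IntervalCyclic

variable {V : Type*}

/-- The colors of two edges at a common vertex `v` differ by at most `d_G(v) - 1`. -/
lemma IsIntervalCyclicColoring.exists_intCast_add_of_adj [Fintype V] {G : SimpleGraph V}
    [DecidableRel G.Adj] {t : ℕ} {c : Sym2 V → ZMod t} (hc : IsIntervalCyclicColoring G t c)
    {v a b : V} (ha : G.Adj v a) (hb : G.Adj v b) :
    ∃ z : ℤ, |z| ≤ (G.degree v - 1 : ℕ) ∧ c s(v, b) = c s(v, a) + z := by
  obtain ⟨k, hk⟩ := hc.2.2 v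
  have key : ∀ x, G.Adj v x → ∃ i < G.degree v, k + (i : ZMod t) = c s(v, x) := by
    intro x hx
    have hmem := Finset.ext_iff.1 hk (c s(v, x))
    have hx' := hmem.1 (Finset.mem_image.2 ⟨x, by simpa using hx, rfl⟩)
    simp only [Finset.mem_image, Finset.bind_def, Finset.mem_sup, Finset.mem_range,
      Finset.pure_def, Finset.mem_singleton] at hx'
    obtain ⟨_, ⟨i, hi, rfl⟩, hix⟩ := hx'
    refine ⟨i, ?_, hix⟩
    convert hi
  obtain ⟨i, hi, hia⟩ := key a ha
  obtain ⟨j, hj, hjb⟩ := key b hb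
  refine ⟨j - i, ?_, ?_⟩
  · rw [abs_le]
    omega
  · rw [← hia, ← hjb]
    push_cast
    ring

/-- The colors of an edge at the start and an edge at the end of a walk differ by at most
the sum of `d_G(x) - 1` along the walk. -/
lemma IsIntervalCyclicColoring.exists_intCast_add_of_walk [Fintype V] {G : SimpleGraph V}
    [DecidableRel G.Adj] {t : ℕ} {c : Sym2 V → ZMod t} (hc : IsIntervalCyclicColoring G t c)
    {u v : V} (p : G.Walk u v) {a b : V} (ha : G.Adj u a) (hb : G.Adj v b) :
    ∃ z : ℤ, |z| ≤ ((p.support.map fun x => G.degree x - 1).sum : ℕ) ∧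
      c s(v, b) = c s(u, a) + z := by
  induction p generalizing a with
  | nil => simpa using hc.exists_intCast_add_of_adj ha hb
  | @cons u w v h p ih =>
    obtain ⟨z₁, hz₁, h₁⟩ := hc.exists_intCast_add_of_adj ha h
    obtain ⟨z₂, hz₂, h₂⟩ := ih h.symm hb
    refine ⟨z₁ + z₂, ?_, ?_⟩
    · rw [SimpleGraph.Walk.support_cons, List.map_cons, List.sum_cons, Nat.cast_add]
      exact (abs_add_le _ _).trans (add_le_add hz₁ hz₂)
    · rw [h₂, Sym2.eq_swap, h₁]
      push_cast
      ring

/-- If all residues modulo `t` lie within distance `N` of a fixed one, then `t ≤ 1 + 2 * N`. -/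
lemma le_of_forall_exists_intCast_add {t N : ℕ} (x₀ : ZMod t)
    (h : ∀ x : ZMod t, ∃ z : ℤ, |z| ≤ N ∧ x = x₀ + z) : t ≤ 1 + 2 * N := by
  have hsurj : (Set.univ : Set (ZMod t)) ⊆
      ((Finset.Icc (-N : ℤ) N).image fun z : ℤ => x₀ + (z : ZMod t) : Finset (ZMod t)) := by
    intro x _
    obtain ⟨z, hz, rfl⟩ := h x
    simpa using ⟨z, abs_le.1 hz, rfl⟩
  have hcard := Set.ncard_le_ncard hsurj (Finset.finite_toSet _)
  rw [Set.ncard_univ, Nat.card_zmod, Set.ncard_coe_finset] at hcard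
  refine (hcard.trans Finset.card_image_le).trans ?_
  rw [Int.card_Icc]
  omega

/-- If `G` is a connected finite simple graph and `G ∈ N_c`, then
`W_c(G) ≤ 1 + 2·max_{P} ∑_{v ∈ V(P)} (d_G(v) − 1)`, where the maximum is over all
shortest paths `P` in `G` (paths whose length equals the distance between their
endpoints). -/
theorem stmt_4 {V : Type*} [Fintype V] (G : SimpleGraph V) [DecidableRel G.Adj]
    [DecidableEq V] (hconn : G.Connected)
    (hNc : ∃ t, HasIntervalCyclicColoring G t) :
    Wc G ≤ 1 + 2 * sSup {s : ℕ | ∃ (u v : V) (p : G.Walk u v), p.IsPath ∧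
      p.length = G.dist u v ∧ s = ∑ x ∈ p.support.toFinset, (G.degree x - 1)} := by
  refine csSup_le hNc ?_
  rintro t ⟨-, c, hc⟩
  obtain ⟨e, he, -⟩ := hc.2.1 0
  induction e using Sym2.ind with | _ u a =>
  refine le_of_forall_exists_intCast_add (c s(u, a)) fun x => ?_
  obtain ⟨f, hf, rfl⟩ := hc.2.1 x
  induction f using Sym2.ind with | _ v b =>
  obtain ⟨p, hp, hlen⟩ := hconn.exists_path_of_dist u v
  obtain ⟨z, hz, hzc⟩ := hc.exists_intCast_add_of_walk p he hf
  refine ⟨z, hz.trans ?_, hzc⟩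
  rw [← List.sum_toFinset _ hp.support_nodup, Nat.cast_le]
  refine le_csSup ⟨∑ x, (G.degree x - 1), ?_⟩ ⟨u, v, p, hp, hlen, rfl⟩
  rintro _ ⟨_, _, q, -, -, rfl⟩
  exact Finset.sum_le_sum_of_subset (Finset.subset_univ _)

end IntervalCyclic
end

section
/- If G is a connected finite simple graph and G ∈ N_c, then W_c(G) ≤ 1 + 2(diam(G) + 1)(Δ(G) − 1), where diam(G) is the diameter of G and Δ(G) is its maximum degree. -/
attribute [local instance] Classical.propDecidable

namespace IntervalCyclic

variable {V : Type*}

/-- The colors of two edges sharing a vertex differ by an integer of absolute value less than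
the degree of that vertex. -/
lemma IsIntervalCyclicColoring.exists_color_eq_add {V : Type*} [Fintype V] {G : SimpleGraph V}
    {t : ℕ} {c : Sym2 V → ZMod t} (hc : IsIntervalCyclicColoring G t c) {v a b : V}
    (ha : G.Adj v a) (hb : G.Adj v b) :
    ∃ z : ℤ, |z| ≤ ((G.degree v - 1 : ℕ) : ℤ) ∧ c s(v, b) = c s(v, a) + z := by
  obtain ⟨k, hk⟩ := hc.2.2 v
  have color_mem : ∀ w, G.Adj v w → ∃ i < G.degree v, k + (i : ZMod t) = c s(v, w) := by
    intro w hw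
    have hmem : c s(v, w) ∈ (G.neighborFinset v).image (fun w => c s(v, w)) :=
      Finset.mem_image_of_mem _ (by simpa using hw)
    rw [hk] at hmem
    obtain ⟨i, hi, h⟩ : ∃ i < G.degree v, (i : ZMod t) = -k + c s(v, w) := by simpa using hmem
    exact ⟨i, hi, by rw [h, add_neg_cancel_left]⟩
  obtain ⟨i, hi, hia⟩ := color_mem a ha
  obtain ⟨j, hj, hjb⟩ := color_mem b hb
  refine ⟨(j : ℤ) - i, abs_le.2 ⟨by omega, by omega⟩, ?_⟩
  rw [← hia, ← hjb]
  push_cast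
  ring

/-- Along a walk of length `d`, the color drifts by at most `(d + 1) * D` when all degrees are at
most `D + 1`. -/
lemma IsIntervalCyclicColoring.exists_color_eq_add_of_walk {V : Type*} [Fintype V]
    {G : SimpleGraph V} {t : ℕ} {c : Sym2 V → ZMod t} (hc : IsIntervalCyclicColoring G t c)
    {D : ℕ} (hD : ∀ v, G.degree v - 1 ≤ D) {u v : V} (p : G.Walk u v) :
    ∀ {a b : V}, G.Adj u a → G.Adj v b →
      ∃ z : ℤ, |z| ≤ (((p.length + 1) * D : ℕ) : ℤ) ∧ c s(v, b) = c s(u, a) + z := by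
  induction p with
  | @nil u =>
    intro a b ha hb
    obtain ⟨z, hz, h⟩ := hc.exists_color_eq_add ha hb
    refine ⟨z, hz.trans ?_, h⟩
    simpa using hD u
  | @cons u x v hux p ih =>
    intro a b ha hb
    obtain ⟨z, hz, h⟩ := hc.exists_color_eq_add ha hux
    obtain ⟨y, hy, h'⟩ := ih hux.symm hb
    refine ⟨z + y, (abs_add_le z y).trans ?_, ?_⟩
    · have hDu : ((G.degree u - 1 : ℕ) : ℤ) ≤ D := by exact_mod_cast hD u
      rw [SimpleGraph.Walk.length_cons]
      push_cast at hy ⊢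
      linarith
    · rw [h', Sym2.eq_swap (a := x), h]
      push_cast
      ring

lemma HasIntervalCyclicColoring.le_of_connected {V : Type*} [Fintype V] {G : SimpleGraph V}
    (hconn : G.Connected) {t D : ℕ} (hD : ∀ v, G.degree v - 1 ≤ D)
    (ht : HasIntervalCyclicColoring G t) : t ≤ 1 + 2 * (G.diam + 1) * D := by
  obtain ⟨htpos, c, hc⟩ := ht
  have : NeZero t := ⟨htpos.ne'⟩
  have := hconn.nonempty
  obtain ⟨e, he, -⟩ := hc.2.1 0
  induction e with | _ u a
  set N : ℤ := (((G.diam + 1) * D : ℕ) : ℤ) with hN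
  have hcover : (Finset.univ : Finset (ZMod t)) ⊆
      (Finset.Icc (-N) N).image (fun z : ℤ => c s(u, a) + (z : ZMod t)) := by
    intro x _
    obtain ⟨f, hf, rfl⟩ := hc.2.1 x
    induction f with | _ v b
    obtain ⟨p, hp⟩ := hconn.exists_walk_length_eq_dist u v
    obtain ⟨z, hz, h⟩ := hc.exists_color_eq_add_of_walk hD p he hf
    have hdist : p.length ≤ G.diam :=
      hp ▸ SimpleGraph.dist_le_diam (SimpleGraph.connected_iff_ediam_ne_top.1 hconn)
    have hzN : |z| ≤ N :=
      hz.trans (Int.ofNat_le.2 (Nat.mul_le_mul_right D (Nat.add_le_add_right hdist 1)))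
    exact Finset.mem_image.2 ⟨z, Finset.mem_Icc.2 (abs_le.1 hzN), h.symm⟩
  have hcard := (Finset.card_le_card hcover).trans Finset.card_image_le
  rw [Finset.card_univ, ZMod.card, Int.card_Icc] at hcard
  rw [mul_assoc]
  omega

/-- If `G` is a connected finite simple graph and `G ∈ N_c`, then
`W_c(G) ≤ 1 + 2(diam(G) + 1)(Δ(G) − 1)`. -/
theorem stmt_5 {V : Type*} [Fintype V] (G : SimpleGraph V) [DecidableRel G.Adj]
    (hconn : G.Connected) (hNc : ∃ t, HasIntervalCyclicColoring G t) :
    Wc G ≤ 1 + 2 * (G.diam + 1) * (G.maxDegree - 1) := by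
  refine csSup_le hNc fun t ht => ht.le_of_connected hconn fun v => Nat.sub_le_sub_right ?_ 1
  convert G.degree_le_maxDegree v

end IntervalCyclic
end

section
/- If G is an interval colorable finite simple graph (G ∈ N), then G ∈ N_c and w_c(G) = Δ(G), the maximum degree of G. -/
attribute [local instance] Classical.propDecidable

namespace IntervalCyclic

variable {V : Type*}

/-- An interval `t`-coloring: a proper edge-coloring with colors `1,…,t` such that all
`t` colors are used and the colors on the edges incident to each vertex form an
interval of consecutive integers. -/
def IsIntervalColoring [Fintype V] (G : SimpleGraph V) (t : ℕ)
    (c : Sym2 V → ℕ) : Prop :=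
  (∀ v w w' : V, G.Adj v w → G.Adj v w' → w ≠ w' → c s(v, w) ≠ c s(v, w')) ∧
  (∀ e ∈ G.edgeSet, c e ∈ Finset.Icc 1 t) ∧
  (∀ x ∈ Finset.Icc 1 t, ∃ e ∈ G.edgeSet, c e = x) ∧
  (∀ v : V, ∃ k : ℕ,
    (G.neighborFinset v).image (fun w => c s(v, w)) =
      (Finset.range (G.degree v)).image (fun i => k + i))

/-- `G` has an interval `t`-coloring for the positive integer `t`. -/
def HasIntervalColoring [Fintype V] (G : SimpleGraph V) (t : ℕ) : Prop :=
  0 < t ∧ ∃ c : Sym2 V → ℕ, IsIntervalColoring G t c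

/-- The greatest `t` for which `G` has an interval `t`-coloring. -/
noncomputable def W [Fintype V] (G : SimpleGraph V) : ℕ :=
  sSup {t | HasIntervalColoring G t}

/-- In an interval cyclic `t`-coloring the edges at a vertex have distinct colors modulo `t`,
so `t` bounds every degree. -/
theorem HasIntervalCyclicColoring.degree_le {V : Type*} [Fintype V] {G : SimpleGraph V} {t : ℕ}
    (h : HasIntervalCyclicColoring G t) (v : V) : G.degree v ≤ t := by
  obtain ⟨ht, c, hc, -, -⟩ := h
  have : NeZero t := ⟨ht.ne'⟩
  rw [← G.card_neighborFinset_eq_degree, ← ZMod.card t, ← Finset.card_univ]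
  refine Finset.card_le_card_of_injOn (fun w => c s(v, w)) (fun _ _ => Finset.mem_univ _) ?_
  intro w hw w' hw' hww
  by_contra hne
  exact hc v w w' (by simpa using hw) (by simpa using hw') hne hww

/-- A graph with an interval coloring has an edge, so its maximum degree is positive. -/
theorem HasIntervalColoring.maxDegree_pos {V : Type*} [Fintype V] {G : SimpleGraph V} {t : ℕ}
    (h : HasIntervalColoring G t) : 0 < G.maxDegree := by
  obtain ⟨ht, c, -, -, hsurj, -⟩ := h
  obtain ⟨e, he, -⟩ := hsurj 1 (Finset.mem_Icc.2 ⟨le_rfl, ht⟩)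
  induction e with
  | _ v w =>
    exact ((G.degree_pos_iff_exists_adj v).2 ⟨w, he⟩).trans_le (G.degree_le_maxDegree v)

/-- Reducing an interval coloring modulo the maximum degree gives an interval cyclic coloring. -/
theorem HasIntervalColoring.hasIntervalCyclicColoring_maxDegree {V : Type*} [Fintype V]
    {G : SimpleGraph V} {t : ℕ} (h : HasIntervalColoring G t) :
    HasIntervalCyclicColoring G G.maxDegree := by
  have hpos := h.maxDegree_pos
  obtain ⟨-, c, hproper, -, -, hint⟩ := h
  have : NeZero G.maxDegree := ⟨hpos.ne'⟩
  refine ⟨hpos, fun e => (c e : ZMod G.maxDegree), ?_, ?_, ?_⟩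
  · intro v w w' hw hw' hne heq
    obtain ⟨k, hk⟩ := hint v
    have hmem : ∀ u, G.Adj v u → ∃ i < G.degree v, k + i = c s(v, u) := fun u hu => by
      have : c s(v, u) ∈ (G.neighborFinset v).image (fun w => c s(v, w)) :=
        Finset.mem_image_of_mem _ (by simpa using hu)
      rw [hk] at this
      simpa using this
    obtain ⟨i, hi, hic⟩ := hmem w hw
    obtain ⟨j, hj, hjc⟩ := hmem w' hw'
    have hle := G.degree_le_maxDegree v
    have hmod : k + i ≡ k + j [MOD G.maxDegree] := by
      rw [hic, hjc]
      exact (ZMod.natCast_eq_natCast_iff _ _ _).1 heq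
    have hij : i = j :=
      Nat.ModEq.eq_of_lt_of_lt (Nat.ModEq.add_left_cancel' k hmod)
        (hi.trans_le hle) (hj.trans_le hle)
    exact hproper v w w' hw hw' hne (by rw [← hic, ← hjc, hij])
  · intro x
    obtain ⟨u, -⟩ : ∃ v : V, 0 < G.degree v := by
      by_contra! hzero
      exact hpos.not_ge (G.maxDegree_le_of_forall_degree_le 0 hzero)
    have : Nonempty V := ⟨u⟩
    obtain ⟨v, hv⟩ := G.exists_maximal_degree_vertex
    obtain ⟨k, hk⟩ := hint v
    have hx : k + (x - k).val ∈ (G.neighborFinset v).image (fun w => c s(v, w)) := by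
      rw [hk]
      exact Finset.mem_image_of_mem _ (Finset.mem_range.2 (hv ▸ ZMod.val_lt _))
    obtain ⟨w, hw, hwx⟩ := Finset.mem_image.1 hx
    refine ⟨s(v, w), by simpa using hw, ?_⟩
    simp only at hwx ⊢
    rw [hwx]
    simp
  · intro v
    obtain ⟨k, hk⟩ := hint v
    refine ⟨k, ?_⟩
    have := congrArg (Finset.image (Nat.cast : ℕ → ZMod G.maxDegree)) hk
    simpa [Finset.image_image, Function.comp_def] using this

/-- If `G` is an interval colorable finite simple graph (`G ∈ N`),
then `G ∈ N_c` and `w_c(G) = Δ(G)`. -/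
theorem stmt_9 {V : Type*} [Fintype V] (G : SimpleGraph V) [DecidableRel G.Adj]
    (hN : ∃ t, HasIntervalColoring G t) :
    (∃ t, HasIntervalCyclicColoring G t) ∧ wc G = G.maxDegree := by
  obtain ⟨t, ht⟩ := hN
  have hc : HasIntervalCyclicColoring G G.maxDegree := by
    convert ht.hasIntervalCyclicColoring_maxDegree
  refine ⟨⟨_, hc⟩, le_antisymm (Nat.sInf_le hc) (le_csInf ⟨_, hc⟩ fun s hs => ?_)⟩
  refine G.maxDegree_le_of_forall_degree_le s fun v => ?_
  convert hs.degree_le v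

end IntervalCyclic
end

section
/- If G is an Eulerian finite simple graph (connected with every vertex of even degree and at least one edge) and the number of edges |E(G)| is odd, then G has no interval cyclic t-coloring for any even positive integer t. -/
attribute [local instance] Classical.propDecidable

namespace IntervalCyclic

variable {V : Type*}

/-- Among `2 * m` consecutive integers shifted by `a`, exactly `m` are odd. -/
theorem card_filter_range_add_eq_one (a : ZMod 2) (m : ℕ) :
    ((Finset.range (2 * m)).filter (fun i : ℕ => a + (i : ZMod 2) = 1)).card = m := by
  induction m with
  | zero => simp
  | succ m ih =>
    have h2 : (2 : ZMod 2) = 0 := rfl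
    rw [Finset.card_filter] at ih ⊢
    rw [show 2 * (m + 1) = 2 * m + 1 + 1 by ring, Finset.sum_range_succ, Finset.sum_range_succ,
      ih]
    push_cast
    rw [h2, zero_mul, zero_add, add_zero]
    obtain rfl | rfl : a = 0 ∨ a = 1 := by clear ih; revert a; decide
    · simp
    · simp [one_add_one_eq_two, h2]

/-- In an interval cyclic coloring with an even number of colors, exactly half of the edges at a
vertex of even degree have odd color. -/
theorem IsIntervalCyclicColoring.two_mul_card_filter_odd [Fintype V] {G : SimpleGraph V} {t : ℕ}
    {c : Sym2 V → ZMod t} (hc : IsIntervalCyclicColoring G t c) (φ : ZMod t →+* ZMod 2) {v : V}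
    (hv : Even (G.degree v)) :
    2 * ((G.neighborFinset v).filter (fun w => φ (c s(v, w)) = 1)).card = G.degree v := by
  obtain ⟨hproper, -, hint⟩ := hc
  obtain ⟨k, hk⟩ := hint v
  obtain ⟨m, hm⟩ := hv
  replace hk : (G.neighborFinset v).image (fun w => c s(v, w)) =
      (Finset.range (G.degree v)).image (fun i : ℕ => k + (i : ZMod t)) := by
    rw [hk]
    ext x
    simp [Finset.bind_def, eq_neg_add_iff_add_eq]
  have hinj : Set.InjOn (fun w => c s(v, w)) (G.neighborFinset v : Set V) := by
    intro w hw w' hw' h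
    by_contra hne
    exact hproper v w w' (by simpa using hw) (by simpa using hw') hne h
  have hinj' : Set.InjOn (fun i : ℕ => k + (i : ZMod t)) (Finset.range (G.degree v) : Set ℕ) := by
    apply Finset.card_image_iff.mp
    rw [← hk, Finset.card_image_of_injOn hinj, Finset.card_range, G.card_neighborFinset_eq_degree]
  have hcount := congrArg (fun s : Finset (ZMod t) => (s.filter (fun x => φ x = 1)).card) hk
  simp only [Finset.filter_image] at hcount
  rw [Finset.card_image_of_injOn (hinj.mono (Finset.coe_subset.mpr (Finset.filter_subset _ _))),
    Finset.card_image_of_injOn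
      (hinj'.mono (Finset.coe_subset.mpr (Finset.filter_subset _ _)))] at hcount
  rw [hcount]
  simp only [map_add, map_natCast]
  rw [hm, ← two_mul]
  congr 1
  convert card_filter_range_add_eq_one (φ k) m

/-- A graph with all degrees even and an interval cyclic coloring with an even number of colors
has an even number of edges. -/
theorem IsIntervalCyclicColoring.even_card_edgeFinset [Fintype V] {G : SimpleGraph V} {t : ℕ}
    {c : Sym2 V → ZMod t} (hc : IsIntervalCyclicColoring G t c) (ht : Even t)
    (heven : ∀ v : V, Even (G.degree v)) : Even G.edgeFinset.card := by
  let φ : ZMod t →+* ZMod 2 := ZMod.castHom ht.two_dvd (ZMod 2)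
  let H : SimpleGraph V :=
    { Adj := fun v w => G.Adj v w ∧ φ (c s(v, w)) = 1
      symm := ⟨fun v w h => ⟨h.1.symm, by rw [Sym2.eq_swap]; exact h.2⟩⟩
      loopless := ⟨fun v h => G.loopless.irrefl v h.1⟩ }
  have hdeg : ∀ v, 2 * H.degree v = G.degree v := by
    intro v
    rw [← hc.two_mul_card_filter_odd φ (heven v), ← H.card_neighborFinset_eq_degree]
    congr 2
    ext w
    simp [H]
  have hG := G.sum_degrees_eq_twice_card_edges
  have hH := H.sum_degrees_eq_twice_card_edges
  simp only [← hdeg, ← Finset.mul_sum] at hG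
  exact ⟨H.edgeFinset.card, by omega⟩

/-- If `G` is an Eulerian finite simple graph (connected with every
vertex of even degree and at least one edge) and `|E(G)|` is odd, then `G` has no
interval cyclic `t`-coloring for any even positive integer `t`. -/
theorem stmt_10 {V : Type*} [Fintype V] (G : SimpleGraph V) [DecidableRel G.Adj]
    (hconn : G.Connected) (heven : ∀ v : V, Even (G.degree v))
    (hedge : G.edgeFinset.Nonempty) (hodd : Odd G.edgeFinset.card) :
    ∀ t : ℕ, 0 < t → Even t → ¬ HasIntervalCyclicColoring G t := by
  rintro t - ht ⟨-, c, hc⟩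
  have h : Even G.edgeFinset.card := by
    convert hc.even_card_edgeFinset ht (fun v => by convert heven v)
  exact (Nat.not_even_iff_odd.mpr hodd) h

end IntervalCyclic
end

section
/- For any odd integer n ≥ 3, the feasible set of the simple cycle C_n on n vertices is exactly the set of odd integers t with 3 ≤ t ≤ n; that is, C_n has an interval cyclic t-coloring if and only if t is odd and 3 ≤ t ≤ n. -/
attribute [local instance] Classical.propDecidable

namespace IntervalCyclic

variable {V : Type*}

/-- In a cycle on at least three vertices, the two neighbors of a vertex are its successor and
its predecessor. -/
lemma cycleGraph_adj_iff_eq (m : ℕ) (v w : Fin (m + 3)) :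
    (SimpleGraph.cycleGraph (m + 3)).Adj v w ↔ w = v + 1 ∨ w = v - 1 := by
  rw [SimpleGraph.cycleGraph_adj]
  constructor
  · rintro (h | h)
    · right; rw [← h]; abel
    · left; rw [← h]; abel
  · rintro (rfl | rfl)
    · right; abel
    · left; abel

lemma fin_add_one_ne_sub_one (m : ℕ) (v : Fin (m + 3)) : v + 1 ≠ v - 1 := by
  intro h
  have h2 : (1 : Fin (m + 3)) + 1 = 0 := by
    have : (1 : Fin (m + 3)) + 1 = (v + 1) - (v - 1) := by abel
    rw [this, h, sub_self]
  have := congrArg Fin.val h2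
  simp [Fin.val_add, Nat.mod_eq_of_lt (show 2 < m + 3 by omega)] at this

/-- The edges `s(i, i + 1)` of a cycle on at least three vertices are pairwise distinct. -/
lemma cycle_edge_injective (m : ℕ) :
    Function.Injective (fun i : Fin (m + 3) => s(i, i + 1)) := by
  intro i j h
  rcases Sym2.eq_iff.1 h with ⟨h, -⟩ | ⟨h, h'⟩
  · exact h
  · exact absurd (h'.trans (eq_sub_of_add_eq h.symm)) (fin_add_one_ne_sub_one m i)

lemma pair_eq_interval_iff {t : ℕ} {a b : ZMod t} (hab : a ≠ b) :
    (∃ k : ZMod t, ({a, b} : Finset (ZMod t)) = {k, k + 1}) ↔ b = a + 1 ∨ a = b + 1 := by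
  constructor
  · rintro ⟨k, hk⟩
    have ha : a ∈ ({k, k + 1} : Finset (ZMod t)) := by rw [← hk]; simp
    have hb : b ∈ ({k, k + 1} : Finset (ZMod t)) := by rw [← hk]; simp
    simp only [Finset.mem_insert, Finset.mem_singleton] at ha hb
    rcases ha with rfl | rfl <;> rcases hb with rfl | rfl <;> simp_all
  · rintro (rfl | rfl)
    · exact ⟨a, rfl⟩
    · exact ⟨b, Finset.pair_comm _ _⟩

/-- An edge-coloring of a cycle is interval cyclic exactly when all colors are used and the colors
of consecutive edges are distinct and differ by one. -/
lemma isIntervalCyclicColoring_cycleGraph_iff (m t : ℕ) (c : Sym2 (Fin (m + 3)) → ZMod t) :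
    IsIntervalCyclicColoring (SimpleGraph.cycleGraph (m + 3)) t c ↔
      Function.Surjective (fun i => c s(i, i + 1)) ∧
      ∀ i, c s(i, i + 1) ≠ c s(i + 1, i + 1 + 1) ∧
        (c s(i + 1, i + 1 + 1) = c s(i, i + 1) + 1 ∨
          c s(i, i + 1) = c s(i + 1, i + 1 + 1) + 1) := by
  have hprev (v : Fin (m + 3)) : s(v, v - 1) = s(v - 1, v - 1 + 1) := by
    rw [sub_add_cancel, Sym2.eq_swap]
  have hproper : (∀ v w w', (SimpleGraph.cycleGraph (m + 3)).Adj v w →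
      (SimpleGraph.cycleGraph (m + 3)).Adj v w' → w ≠ w' → c s(v, w) ≠ c s(v, w')) ↔
      ∀ i, c s(i, i + 1) ≠ c s(i + 1, i + 1 + 1) := by
    simp only [cycleGraph_adj_iff_eq]
    constructor
    · intro h i
      have := h (i + 1) (i + 1 - 1) (i + 1 + 1) (.inr rfl) (.inl rfl)
        (fin_add_one_ne_sub_one m _).symm
      rwa [hprev, add_sub_cancel_right] at this
    · rintro h v w w' hw hw' hne
      have := h (v - 1)
      rw [← hprev, sub_add_cancel] at this
      rcases hw with rfl | rfl <;> rcases hw' with rfl | rfl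
      · exact absurd rfl hne
      · exact this.symm
      · exact this
      · exact absurd rfl hne
  have hsurj : (∀ x, ∃ e ∈ (SimpleGraph.cycleGraph (m + 3)).edgeSet, c e = x) ↔
      Function.Surjective (fun i => c s(i, i + 1)) := by
    refine forall_congr' fun x => ⟨?_, ?_⟩
    · rintro ⟨e, he, rfl⟩
      induction e using Sym2.ind with
      | _ v w =>
        rcases (cycleGraph_adj_iff_eq m v w).1 he with rfl | rfl
        · exact ⟨v, rfl⟩
        · exact ⟨v - 1, congrArg c (hprev v).symm⟩
    · rintro ⟨i, rfl⟩
      exact ⟨_, (cycleGraph_adj_iff_eq m _ _).2 (.inl rfl), rfl⟩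
  have hN (v : Fin (m + 3)) [Fintype ((SimpleGraph.cycleGraph (m + 3)).neighborSet v)] :
      (SimpleGraph.cycleGraph (m + 3)).neighborFinset v = {v - 1, v + 1} := by
    ext w
    simp [cycleGraph_adj_iff_eq, or_comm]
  have hd (v : Fin (m + 3)) [Fintype ((SimpleGraph.cycleGraph (m + 3)).neighborSet v)] :
      (SimpleGraph.cycleGraph (m + 3)).degree v = 2 := by
    rw [SimpleGraph.degree, hN, Finset.card_pair (fin_add_one_ne_sub_one m v).symm]
  have hcoloring : IsIntervalCyclicColoring (SimpleGraph.cycleGraph (m + 3)) t c ↔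
      (∀ i, c s(i, i + 1) ≠ c s(i + 1, i + 1 + 1)) ∧
      Function.Surjective (fun i => c s(i, i + 1)) ∧
      ∀ v : Fin (m + 3), ∃ k : ZMod t,
        ({c s(v - 1, v - 1 + 1), c s(v, v + 1)} : Finset (ZMod t)) = {k, k + 1} := by
    refine and_congr hproper (and_congr hsurj (forall_congr' fun v => ?_))
    rw [hN, hd]
    simp [Finset.range_add_one, Finset.image_insert, hprev, Finset.pair_comm]
  rw [hcoloring]
  constructor
  · rintro ⟨h1, h2, h3⟩
    refine ⟨h2, fun i => ⟨h1 i, (pair_eq_interval_iff (h1 i)).1 ?_⟩⟩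
    have := h3 (i + 1)
    rwa [add_sub_cancel_right] at this
  · rintro ⟨h2, h⟩
    refine ⟨fun i => (h i).1, h2, fun v => ?_⟩
    have := (pair_eq_interval_iff (h (v - 1)).1).2 (h (v - 1)).2
    rwa [sub_add_cancel] at this ⊢

/-- Around an odd cycle, colors changing by `±1` at each step cannot live modulo an even number. -/
lemma odd_of_cyclic_steps {m t : ℕ} (hodd : Odd (m + 3)) (g : Fin (m + 3) → ZMod t)
    (hg : ∀ i, g (i + 1) = g i + 1 ∨ g i = g (i + 1) + 1) : Odd t := by
  by_contra ht
  have h2 : 2 ∣ t := even_iff_two_dvd.1 (Nat.not_odd_iff_even.1 ht)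
  let φ := ZMod.castHom h2 (ZMod 2)
  have hstep (i : Fin (m + 3)) : φ (g (i + 1)) = φ (g i) + 1 := by
    rcases hg i with h | h
    · rw [h, map_add, map_one]
    · rw [h, map_add, map_one, add_assoc, CharTwo.add_self_eq_zero, add_zero]
  have hsum : ∑ i, φ (g (i + 1)) = ∑ i, φ (g i) :=
    Equiv.sum_comp (Equiv.addRight (1 : Fin (m + 3))) fun i => φ (g i)
  simp only [hstep, Finset.sum_add_distrib, Finset.sum_const, Finset.card_univ,
    Fintype.card_fin, nsmul_eq_mul, mul_one, add_eq_left] at hsum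
  exact Nat.not_even_iff_odd.2 hodd (ZMod.natCast_eq_zero_iff_even.1 hsum)

/-- The colors `0, 1, …, t - 1` followed by an alternation of `0` and `-1`. -/
def zigzag (t i : ℕ) : ZMod t :=
  if i < t then i else if i % 2 = 1 then 0 else -1

lemma zigzag_step {t i : ℕ} (ht : Odd t) :
    zigzag t (i + 1) = zigzag t i + 1 ∨ zigzag t i = zigzag t (i + 1) + 1 := by
  rw [Nat.odd_iff] at ht
  unfold zigzag
  rcases lt_trichotomy (i + 1) t with h | rfl | h
  · left
    rw [if_pos h, if_pos (by omega)]
    push_cast; rfl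
  · left
    have := ZMod.natCast_self (i + 1)
    rw [if_neg (by omega), if_pos ht, if_pos (by omega)]
    push_cast at this
    exact this.symm
  · rw [if_neg (show ¬ i + 1 < t by omega), if_neg (show ¬ i < t by omega)]
    rcases Nat.mod_two_eq_zero_or_one i with hi | hi
    · left
      rw [if_pos (by omega), if_neg (by omega)]; ring
    · right
      rw [if_pos hi, if_neg (by omega)]; ring

lemma zigzag_last {t n : ℕ} (ht : Odd t) (hn : Odd (n + 1)) (h : t ≤ n + 1) :
    zigzag t n = -1 := by
  unfold zigzag
  rw [Nat.odd_iff] at hn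
  split_ifs with h1 h2
  · have h3 : t = n + 1 := by omega
    subst h3
    have := ZMod.natCast_self (n + 1)
    push_cast at this
    exact eq_neg_of_add_eq_zero_left this
  · omega
  · rfl

/-- For any odd integer `n ≥ 3`, the feasible set of the simple
cycle `C_n` on `n` vertices is exactly the set of odd integers `t` with
`3 ≤ t ≤ n`: the cycle `C_n` has an interval cyclic `t`-coloring if and only if
`t` is odd and `3 ≤ t ≤ n`. -/
theorem stmt_12 (n : ℕ) (hn : 3 ≤ n) (hodd : Odd n) :
    ∀ t : ℕ, HasIntervalCyclicColoring (SimpleGraph.cycleGraph n) t ↔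
      (Odd t ∧ 3 ≤ t ∧ t ≤ n) := by
  intro t
  obtain ⟨m, rfl⟩ := Nat.exists_eq_add_of_le' hn
  simp only [HasIntervalCyclicColoring, isIntervalCyclicColoring_cycleGraph_iff]
  constructor
  · rintro ⟨hpos, c, hsurj, hstep⟩
    have ht : Odd t := odd_of_cyclic_steps hodd (fun i => c s(i, i + 1)) fun i => (hstep i).2
    have ht1 : t ≠ 1 := by
      rintro rfl
      exact (hstep 0).1 (Subsingleton.elim _ _)
    have : NeZero t := ⟨hpos.ne'⟩
    have hcard := Fintype.card_le_of_surjective _ hsurj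
    rw [ZMod.card, Fintype.card_fin] at hcard
    refine ⟨ht, ?_, hcard⟩
    rw [Nat.odd_iff] at ht
    omega
  · rintro ⟨ht, h3, hle⟩
    have : Fact (1 < t) := ⟨by omega⟩
    have : NeZero t := ⟨by omega⟩
    obtain ⟨c, hc⟩ : ∃ c : Sym2 (Fin (m + 3)) → ZMod t,
        ∀ i : Fin (m + 3), c s(i, i + 1) = zigzag t i :=
      ⟨Function.extend (fun i => s(i, i + 1)) (fun i => zigzag t i) 0,
        fun i => (cycle_edge_injective m).extend_apply _ _ i⟩
    refine ⟨by omega, c, fun x => ?_, fun i => ?_⟩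
    · refine ⟨⟨x.val, (ZMod.val_lt x).trans_le hle⟩, ?_⟩
      simp only [hc, zigzag, if_pos (ZMod.val_lt x), ZMod.natCast_zmod_val]
    · simp only [hc]
      have key : zigzag t (i + 1 : Fin (m + 3)) = zigzag t i + 1 ∨
          zigzag t i = zigzag t (i + 1 : Fin (m + 3)) + 1 := by
        rw [Fin.val_add_one]
        split_ifs with hi
        · left
          rw [hi, Fin.val_last, zigzag_last ht hodd hle]
          simp [zigzag, show 0 < t by omega]
        · exact zigzag_step ht
      refine ⟨fun h => ?_, key⟩
      rw [h] at key
      simp at key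

end IntervalCyclic
end

section
/- For every positive integer n, the complete graph K_{2n+1} on 2n+1 vertices admits an interval cyclic 3n-coloring; consequently W_c(K_{2n+1}) ≥ 3n. -/
attribute [local instance] Classical.propDecidable

namespace IntervalCyclic

variable {V : Type*}

/-- A symmetric integer labelling of the edges of the complete graph on `{0, …, 2n}`. On
`{0, …, 2n - 1}` it lifts the round-robin one-factorization so that the labels at `v` form an
interval starting at `v / 2 + 1`; the vertex `2n` extends that interval by one, downwards if `v`
is even and upwards if `v` is odd. -/
def edgeLabel (n u v : ℕ) : ℕ :=
  if max u v = 2 * n then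
    if min u v % 2 = 0 then min u v / 2 else min u v / 2 + 2 * n
  else if max u v = 2 * n - 1 then min u v + n
  else if (u + v) % 2 = 1 then (u + v + 1) / 2
  else (u + v) / 2 + n

theorem edgeLabel_comm (n u v : ℕ) : edgeLabel n u v = edgeLabel n v u := by
  simp only [edgeLabel, max_comm u v, min_comm u v, add_comm u v]

theorem edgeLabel_lt {n u v : ℕ} (hu : u < 2 * n + 1) (hv : v < 2 * n + 1) (huv : u ≠ v) :
    edgeLabel n u v < 3 * n := by
  unfold edgeLabel
  split_ifs <;> omega

theorem edgeLabel_injective {n u v w : ℕ} (hu : u < 2 * n + 1) (hv : v < 2 * n + 1)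
    (hw : w < 2 * n + 1) (huv : u ≠ v) (huw : u ≠ w)
    (h : edgeLabel n u v = edgeLabel n u w) : v = w := by
  unfold edgeLabel at h
  split_ifs at h <;> omega

theorem edgeLabel_mem_window {n u v : ℕ} (hu : u < 2 * n) (hv : v < 2 * n + 1) (_ : u ≠ v) :
    (u + 1) / 2 ≤ edgeLabel n u v ∧ edgeLabel n u v < (u + 1) / 2 + 2 * n := by
  unfold edgeLabel
  split_ifs <;> omega

theorem edgeLabel_last {n v : ℕ} (hv : v < 2 * n) :
    edgeLabel n (2 * n) v < n ∨
      2 * n ≤ edgeLabel n (2 * n) v ∧ edgeLabel n (2 * n) v < 3 * n := by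
  unfold edgeLabel
  split_ifs <;> omega

theorem exists_edgeLabel_eq {n x : ℕ} (hx : x < 3 * n) :
    ∃ u v, u < 2 * n + 1 ∧ v < 2 * n + 1 ∧ u ≠ v ∧ edgeLabel n u v = x := by
  rcases lt_or_ge x n with h | h
  · refine ⟨2 * n, 2 * x, by omega, by omega, by omega, ?_⟩
    unfold edgeLabel
    split_ifs <;> omega
  rcases eq_or_ne x (3 * n - 1) with h' | h'
  · refine ⟨2 * n - 1, 2 * n, by omega, by omega, by omega, ?_⟩
    unfold edgeLabel
    split_ifs <;> omega
  · refine ⟨2 * n - 1, x - n, by omega, by omega, by omega, ?_⟩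
    unfold edgeLabel
    split_ifs <;> omega

/-- Every label at the vertex `u` lies in a cyclic window of `2n` colors modulo `3n`. -/
theorem exists_cyclic_window (n u : ℕ) (hu : u < 2 * n + 1) :
    ∃ k : ZMod (3 * n), ∀ v < 2 * n + 1, u ≠ v →
      ∃ i < 2 * n, k + (i : ZMod (3 * n)) = (edgeLabel n u v : ZMod (3 * n)) := by
  rcases eq_or_ne u (2 * n) with rfl | h
  · refine ⟨((2 * n : ℕ) : ZMod (3 * n)), fun v hv huv => ?_⟩
    rcases edgeLabel_last (n := n) (v := v) (by omega) with h | ⟨h, h'⟩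
    · refine ⟨edgeLabel n (2 * n) v + n, by omega, ?_⟩
      rw [← Nat.cast_add, show 2 * n + (edgeLabel n (2 * n) v + n)
        = edgeLabel n (2 * n) v + 3 * n by ring, Nat.cast_add _ (3 * n), ZMod.natCast_self,
        add_zero]
    · refine ⟨edgeLabel n (2 * n) v - 2 * n, by omega, ?_⟩
      rw [← Nat.cast_add, Nat.add_sub_cancel' h]
  · refine ⟨(((u + 1) / 2 : ℕ) : ZMod (3 * n)), fun v hv huv => ?_⟩
    have := edgeLabel_mem_window (n := n) (u := u) (by omega) hv huv
    refine ⟨edgeLabel n u v - (u + 1) / 2, by omega, ?_⟩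
    rw [← Nat.cast_add, Nat.add_sub_cancel' this.1]

/-- The coloring of the edges of `K_{2n+1}` by the residues modulo `3n` of `edgeLabel`. -/
def edgeColoring (n : ℕ) : Sym2 (Fin (2 * n + 1)) → ZMod (3 * n) :=
  Sym2.lift ⟨fun u v => (edgeLabel n u v : ZMod (3 * n)), fun u v => congrArg _ (edgeLabel_comm n u v)⟩

theorem edgeColoring_mk (n : ℕ) (u v : Fin (2 * n + 1)) :
    edgeColoring n s(u, v) = (edgeLabel n u v : ZMod (3 * n)) := rfl

theorem edgeColoring_injective {n : ℕ} {u v w : Fin (2 * n + 1)} (huv : u ≠ v) (huw : u ≠ w)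
    (h : edgeColoring n s(u, v) = edgeColoring n s(u, w)) : v = w := by
  have huv' := Fin.val_ne_of_ne huv
  have huw' := Fin.val_ne_of_ne huw
  rw [edgeColoring_mk, edgeColoring_mk, ZMod.natCast_eq_natCast_iff] at h
  exact Fin.ext (edgeLabel_injective u.2 v.2 w.2 huv' huw'
    (h.eq_of_lt_of_lt (edgeLabel_lt u.2 v.2 huv') (edgeLabel_lt u.2 w.2 huw')))

/-- The monadic coercion of `Finset.range m` to residues modulo `t` is the image under the cast. -/
theorem coe_range_zmod (m t : ℕ) :
    ((do let a ← Finset.range m; pure (a : ZMod t)) : Finset (ZMod t)) =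
      (Finset.range m).image Nat.cast := by
  ext x
  simp [eq_comm]

/-- If the colors at `u` are distinct and lie in a window of `d_G(u)` consecutive residues, they
fill that window. -/
theorem image_neighborFinset_eq_window [Fintype V] {G : SimpleGraph V} {t : ℕ}
    {c : Sym2 V → ZMod t} {u : V} {k : ZMod t}
    (hc : ∀ v w, G.Adj u v → G.Adj u w → c s(u, v) = c s(u, w) → v = w)
    (hk : ∀ v, G.Adj u v → ∃ i < G.degree u, k + (i : ZMod t) = c s(u, v)) :
    (G.neighborFinset u).image (fun w => c s(u, w)) =
      (Finset.range (G.degree u)).image (fun i => k + (i : ZMod t)) := by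
  rw [coe_range_zmod, Finset.image_image]
  refine Finset.eq_of_subset_of_card_le ?_ ?_
  · intro x hx
    obtain ⟨v, hv, rfl⟩ := Finset.mem_image.1 hx
    obtain ⟨i, hi, h⟩ := hk v ((SimpleGraph.mem_neighborFinset _ _ _).1 hv)
    exact Finset.mem_image.2 ⟨i, Finset.mem_range.2 hi, h⟩
  · rw [Finset.card_image_of_injOn (s := G.neighborFinset u), SimpleGraph.card_neighborFinset_eq_degree]
    · exact Finset.card_image_le.trans (Finset.card_range _).le
    · intro v hv w hw h
      exact hc v w (by simpa using hv) (by simpa using hw) h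

theorem isIntervalCyclicColoring_edgeColoring {n : ℕ} (hn : 0 < n) :
    IsIntervalCyclicColoring (⊤ : SimpleGraph (Fin (2 * n + 1))) (3 * n) (edgeColoring n) := by
  refine ⟨fun v w w' hw hw' hne h => hne (edgeColoring_injective hw hw' h), fun x => ?_,
    fun u => ?_⟩
  · have : NeZero (3 * n) := ⟨by omega⟩
    obtain ⟨u, v, hu, hv, huv, h⟩ := exists_edgeLabel_eq (ZMod.val_lt x)
    refine ⟨s(⟨u, hu⟩, ⟨v, hv⟩), ?_, ?_⟩
    · simpa [SimpleGraph.mem_edgeSet] using huv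
    · rw [edgeColoring_mk, h, ZMod.natCast_zmod_val]
  · obtain ⟨k, hk⟩ := exists_cyclic_window n u u.2
    have hdeg (_ : Fintype ((⊤ : SimpleGraph (Fin (2 * n + 1))).neighborSet u)) :
        (⊤ : SimpleGraph (Fin (2 * n + 1))).degree u = 2 * n := by
      have h := SimpleGraph.complete_graph_degree u
      rw [Fintype.card_fin, Nat.add_sub_cancel] at h
      convert h
    refine ⟨k, image_neighborFinset_eq_window (fun v w => edgeColoring_injective) fun v huv => ?_⟩
    rw [hdeg]
    exact hk v v.2 (Fin.val_ne_of_ne huv)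

theorem bddAbove_hasIntervalCyclicColoring [Fintype V] (G : SimpleGraph V) :
    BddAbove {t | HasIntervalCyclicColoring G t} := by
  refine ⟨Fintype.card (Sym2 V), ?_⟩
  rintro t ⟨ht, c, -, hc, -⟩
  have : NeZero t := ⟨ht.ne'⟩
  rw [← ZMod.card t]
  exact Fintype.card_le_of_surjective c fun x => (hc x).imp fun _ h => h.2

/-- For every positive integer `n`, the complete graph `K_{2n+1}`
admits an interval cyclic `3n`-coloring; consequently `W_c(K_{2n+1}) ≥ 3n`. -/
theorem stmt_13 (n : ℕ) (hn : 0 < n) :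
    HasIntervalCyclicColoring (⊤ : SimpleGraph (Fin (2 * n + 1))) (3 * n) ∧
      3 * n ≤ Wc (⊤ : SimpleGraph (Fin (2 * n + 1))) := by
  have h : HasIntervalCyclicColoring (⊤ : SimpleGraph (Fin (2 * n + 1))) (3 * n) :=
    ⟨by omega, edgeColoring n, isIntervalCyclicColoring_edgeColoring hn⟩
  exact ⟨h, le_csSup (bddAbove_hasIntervalCyclicColoring _) h⟩

end IntervalCyclic
end
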